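/- arXiv:1710.10018 — 2 statements merged into one kernel-verified Lean document; each statement's English description precedes it below -/
import Mathlib

section
/- Let (R, m, k) be a Noetherian local ring and let X be a resolving subcategory of finitely generated R-modules closed under cosyzygies (Ω⁻¹X ⊆ X). Then either k ∈ X or every module in X is totally reflexive. -/
open CategoryTheory

noncomputable section

namespace Paper

variable (R : Type) [CommRing R]

/-- finitely generated projective module (object of `add R`) -/
def FGProj (M : ModuleCat.{0} R) : Prop := Module.Finite R M ∧ Module.Projective R M

/-- a short exact sequence `0 → L → M → N → 0` -/
def SES {L M N : ModuleCat.{0} R} (f : L →ₗ[R] M) (g : M →ₗ[R] N) : Prop :=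
  Function.Injective f ∧ Function.Surjective g ∧ LinearMap.ker g = LinearMap.range f

/-- `N` is a first syzygy of `M`: kernel of a surjection from a f.g. projective onto `M`. -/
def IsSyzygy (N M : ModuleCat.{0} R) : Prop :=
  ∃ (P : ModuleCat.{0} R) (f : P →ₗ[R] M), FGProj R P ∧ Function.Surjective f ∧
    Nonempty (N ≃ₗ[R] LinearMap.ker f)

/-- `N` is an `n`-th syzygy of `M` -/
def IsNthSyzygy : ℕ → ModuleCat.{0} R → ModuleCat.{0} R → Prop
  | 0, N, M => Nonempty (N ≃ₗ[R] M)
  | (n+1), N, M => ∃ K : ModuleCat.{0} R, IsNthSyzygy n K M ∧ IsSyzygy R N K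

/-- `f : M → P` is a left `add R`-approximation -/
def IsLeftApprox {M P : ModuleCat.{0} R} (f : M →ₗ[R] P) : Prop :=
  FGProj R P ∧ ∀ (Q : ModuleCat.{0} R), FGProj R Q → ∀ g : M →ₗ[R] Q,
    ∃ h : P →ₗ[R] Q, h.comp f = g

/-- `N` is a first cosyzygy of `M`: cokernel of a left `add R`-approximation. -/
def IsCosyzygy (N M : ModuleCat.{0} R) : Prop :=
  ∃ (P : ModuleCat.{0} R) (f : M →ₗ[R] P), IsLeftApprox R f ∧
    Nonempty (N ≃ₗ[R] (P ⧸ LinearMap.range f))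

/-- `N` is an `n`-th cosyzygy of `M` -/
def IsNthCosyzygy : ℕ → ModuleCat.{0} R → ModuleCat.{0} R → Prop
  | 0, N, M => Nonempty (N ≃ₗ[R] M)
  | (n+1), N, M => ∃ K : ModuleCat.{0} R, IsNthCosyzygy n K M ∧ IsCosyzygy R N K

/-- `T` is an (Auslander) transpose of `M` -/
def IsTranspose (T M : ModuleCat.{0} R) : Prop :=
  ∃ (P₁ P₀ : ModuleCat.{0} R) (d : P₁ →ₗ[R] P₀) (p : P₀ →ₗ[R] M),
    FGProj R P₁ ∧ FGProj R P₀ ∧ Function.Surjective p ∧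
    LinearMap.ker p = LinearMap.range d ∧
    Nonempty (T ≃ₗ[R] ((Module.Dual R P₁) ⧸ LinearMap.range d.dualMap))

/-- stably isomorphic: `M ⊕ P ≅ N ⊕ Q` with `P`, `Q` f.g. projective -/
def StablyIso (M N : ModuleCat.{0} R) : Prop :=
  ∃ P Q : ModuleCat.{0} R, FGProj R P ∧ FGProj R Q ∧
    Nonempty ((M × P) ≃ₗ[R] (N × Q))

/-- resolving subcategory of `mod R` -/
structure Resolving (X : ModuleCat.{0} R → Prop) : Prop where
  fg : ∀ M, X M → Module.Finite R M
  proj : ∀ M : ModuleCat.{0} R, FGProj R M → X M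
  summand : ∀ M N N' : ModuleCat.{0} R, X M → Nonempty (M ≃ₗ[R] N × N') → X N
  extension : ∀ (L M N : ModuleCat.{0} R) (f : L →ₗ[R] M) (g : M →ₗ[R] N),
      SES R f g → X L → X N → X M
  ker_epi : ∀ (L M N : ModuleCat.{0} R) (f : L →ₗ[R] M) (g : M →ₗ[R] N),
      SES R f g → X M → X N → X L

/-- `Ext^i_R(M, N) = 0` -/
def ExtVanish (M N : ModuleCat.{0} R) (i : ℕ) : Prop :=
  Subsingleton (((Ext R (ModuleCat.{0} R) i).obj (Opposite.op M)).obj N)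

/-- totally reflexive (Gorenstein dimension zero) module -/
def TotallyReflexive (M : ModuleCat.{0} R) : Prop :=
  Function.Bijective (Module.Dual.eval R M) ∧
  ∀ i : ℕ, 0 < i → ExtVanish R M (ModuleCat.of R R) i ∧
    ExtVanish R (ModuleCat.of R (Module.Dual R M)) (ModuleCat.of R R) i

/-- `M` has finite projective dimension -/
def FiniteProjDim (M : ModuleCat.{0} R) : Prop :=
  ∃ (n : ℕ) (N : ModuleCat.{0} R), IsNthSyzygy R n N M ∧ FGProj R N

/-- additive closure of a family of modules -/
def AddClosure (S : ModuleCat.{0} R → Prop) (M : ModuleCat.{0} R) : Prop :=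
  ∃ (k : ℕ) (f : Fin k → ModuleCat.{0} R) (N : ModuleCat.{0} R),
    (∀ i, S (f i)) ∧ Nonempty ((M × N) ≃ₗ[R] ((i : Fin k) → f i))

/-- the operation `[−]`: `add` closure of `R` and all syzygies of modules of `Y` -/
def Bracket (Y : ModuleCat.{0} R → Prop) : ModuleCat.{0} R → Prop :=
  AddClosure R (fun N => FGProj R N ∨ ∃ (M : ModuleCat.{0} R) (i : ℕ), Y M ∧ IsNthSyzygy R i N M)

/-- `Y ∘ Z`: extensions of a module of `Z` by a module of `Y` -/
def ExtOf (Y Z : ModuleCat.{0} R → Prop) (M : ModuleCat.{0} R) : Prop :=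
  ∃ (A B : ModuleCat.{0} R) (f : A →ₗ[R] M) (g : M →ₗ[R] B), Y A ∧ Z B ∧ SES R f g

/-- the ball `[C]_n` of radius `n` centered at `C` -/
def Ball (C : ModuleCat.{0} R) : ℕ → ModuleCat.{0} R → Prop
  | 0 => fun _ => False
  | 1 => Bracket R (fun M => Nonempty (M ≃ₗ[R] C))
  | (n+2) => Bracket R (ExtOf R (Ball C (n+1)) (Bracket R (fun M => Nonempty (M ≃ₗ[R] C))))

/-- `X` has finite radius: `X ⊆ [C]_{n+1}` for some `C ∈ X`. -/
def FiniteRadius (X : ModuleCat.{0} R → Prop) : Prop :=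
  ∃ (C : ModuleCat.{0} R) (n : ℕ), X C ∧ ∀ M, X M → Ball R C (n + 1) M

/-- `depth_A M ≥ n`: there is a weakly `M`-regular sequence of length `n` in the maximal ideal -/
def DepthGE (A : Type) [CommRing A] [IsLocalRing A]
    (M : Type) [AddCommGroup M] [Module A M] (n : ℕ) : Prop :=
  ∃ rs : List A, rs.length = n ∧ (∀ x ∈ rs, x ∈ IsLocalRing.maximalIdeal A) ∧
    RingTheory.Sequence.IsWeaklyRegular M rs

/-- `M` is free at the prime `p` -/
def FreeAt (M : ModuleCat.{0} R) (p : PrimeSpectrum R) : Prop :=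
  Module.Free (Localization.AtPrime p.asIdeal) (LocalizedModule p.asIdeal.primeCompl M)

/-- locally free on the punctured spectrum of a local ring -/
def LocFreeOnPunctured [IsLocalRing R] (M : ModuleCat.{0} R) : Prop :=
  ∀ p : PrimeSpectrum R, p.asIdeal ≠ IsLocalRing.maximalIdeal R → FreeAt R M p

/-- a Gorenstein local ring: `R` has finite injective dimension over itself -/
def Gorenstein : Prop :=
  ∃ n : ℕ, ∀ i : ℕ, n < i → ∀ M : ModuleCat.{0} R, ExtVanish R M (ModuleCat.of R R) i

/-- the annihilator of the `i`-th local cohomology module `H^i_I(M)` -/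
def aa (I : Ideal R) (i : ℕ) (M : ModuleCat.{0} R) : Ideal R :=
  Module.annihilator R ((localCohomology I i).obj M)

/-- an Ulrich module over a CM local ring of dimension `d` -/
def Ulrich [IsLocalRing R] (d : ℕ) (U : ModuleCat.{0} R) : Prop :=
  Module.Finite R U ∧ DepthGE R U d ∧ ¬ Subsingleton U ∧
  ∃ xs : List R, xs.length = d ∧ (∀ x ∈ xs, x ∈ IsLocalRing.maximalIdeal R) ∧
    RingTheory.Sequence.IsWeaklyRegular U xs ∧
    (IsLocalRing.maximalIdeal R) • (⊤ : Submodule R U) = Ideal.ofList xs • ⊤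

end Paper

open Paper

namespace S16

section basics
variable {R : Type} [CommRing R]

/-- every functional extends along `f` -/
def DualSurj {M P : Type} [AddCommGroup M] [Module R M] [AddCommGroup P] [Module R P]
    (f : M →ₗ[R] P) : Prop := ∀ a : M →ₗ[R] R, ∃ b : P →ₗ[R] R, ∀ m, b (f m) = a m

/-- vanishing of `Ext^1(M,R)` -/
def E1 (R : Type) [CommRing R] (M : Type) [AddCommGroup M] [Module R M] : Prop :=
  ∀ (B : Type) [AddCommGroup B] [Module R B] (g : B →ₗ[R] M), Function.Surjective g →
    DualSurj (LinearMap.ker g).subtype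

/-- torsionless modules -/
def TL (R : Type) [CommRing R] (M : Type) [AddCommGroup M] [Module R M] : Prop :=
  ∀ m : M, (∀ a : M →ₗ[R] R, a m = 0) → m = 0

/-- torsion submodule: kernel of the evaluation -/
def tt (R : Type) [CommRing R] (M : Type) [AddCommGroup M] [Module R M] : Submodule R M :=
  LinearMap.ker (Module.Dual.eval R M)

/-- unbundled short exact sequences -/
structure SE {K B M : Type} [AddCommGroup K] [Module R K] [AddCommGroup B] [Module R B]
    [AddCommGroup M] [Module R M] (i : K →ₗ[R] B) (g : B →ₗ[R] M) : Prop where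
  inj : Function.Injective i
  surj : Function.Surjective g
  zero : ∀ k, g (i k) = 0
  ex : ∀ b, g b = 0 → ∃ k, i k = b

variable {K B M N P : Type} [AddCommGroup K] [Module R K] [AddCommGroup B] [Module R B]
    [AddCommGroup M] [Module R M] [AddCommGroup N] [Module R N] [AddCommGroup P] [Module R P]

lemma mem_tt (m : M) : m ∈ tt R M ↔ ∀ a : M →ₗ[R] R, a m = 0 := by
  unfold tt
  rw [LinearMap.mem_ker, LinearMap.ext_iff]
  rfl

lemma desc (g : B →ₗ[R] M) (hg : Function.Surjective g) (ψ : B →ₗ[R] N)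
    (h : ∀ b, g b = 0 → ψ b = 0) : ∃ θ : M →ₗ[R] N, ∀ b, θ (g b) = ψ b := by
  refine ⟨(LinearMap.ker g).liftQ ψ (fun b hb => h b hb) ∘ₗ
    (g.quotKerEquivOfSurjective hg).symm.toLinearMap, fun b => ?_⟩
  have : (g.quotKerEquivOfSurjective hg).symm (g b) = Submodule.Quotient.mk b := by
    rw [LinearEquiv.symm_apply_eq]; rfl
  simp only [LinearMap.comp_apply, LinearEquiv.coe_coe, this]
  rfl

lemma exists_cover (R : Type) [CommRing R] (M : Type) [AddCommGroup M] [Module R M] :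
    ∃ (F : Type) (_ : AddCommGroup F) (_ : Module R F) (p : F →ₗ[R] M),
      Module.Free R F ∧ Function.Surjective p :=
  ⟨M →₀ R, inferInstance, inferInstance, Finsupp.linearCombination R (id : M → M),
    inferInstance, Finsupp.linearCombination_id_surjective R M⟩

lemma lift_inj (i : K →ₗ[R] B) (hi : Function.Injective i) (ψ : N →ₗ[R] B)
    (h : ∀ n, ∃ k, i k = ψ n) : ∃ θ : N →ₗ[R] K, ∀ n, i (θ n) = ψ n := by
  choose t ht using h
  refine ⟨{ toFun := t, map_add' := ?_, map_smul' := ?_ }, ht⟩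
  · intro a b; apply hi; simp [ht]
  · intro a b; apply hi; simp [ht]

lemma SE.ofSurj (g : B →ₗ[R] M) (hg : Function.Surjective g) :
    SE (LinearMap.ker g).subtype g :=
  ⟨Subtype.val_injective, hg, fun k => k.2, fun b hb => ⟨⟨b, hb⟩, rfl⟩⟩

lemma SE.ofInj (i : K →ₗ[R] B) (hi : Function.Injective i) :
    SE i (LinearMap.range i).mkQ :=
  ⟨hi, Submodule.mkQ_surjective _, fun k => by simp, fun b hb => by
    simpa using hb⟩

lemma SE.ofSub (A : Submodule R B) : SE A.subtype A.mkQ :=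
  ⟨Subtype.val_injective, Submodule.mkQ_surjective _, fun k => by simp, fun b hb => by
    simpa using hb⟩

lemma E1_of_proj [Module.Projective R P] (p : P →ₗ[R] M) (hp : Function.Surjective p)
    (h : DualSurj (LinearMap.ker p).subtype) : E1 R M := by
  intro B _ _ g hg a
  obtain ⟨l, hl⟩ := Module.projective_lifting_property g p hg
  have hl' : ∀ x, g (l x) = p x := fun x => by rw [← hl]; rfl
  let l' : LinearMap.ker p →ₗ[R] LinearMap.ker g :=
    (l ∘ₗ (LinearMap.ker p).subtype).codRestrict _ (fun x => by
      simp [hl'])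
  obtain ⟨b0, hb0⟩ := h (a ∘ₗ l')
  have hb0' : ∀ (x : P) (hx : p x = 0) , b0 x = a ⟨l x, by simp [hl', hx]⟩ :=
    fun x hx => hb0 ⟨x, hx⟩
  obtain ⟨θ, hθ⟩ := desc (l.coprod (LinearMap.ker g).subtype) (fun b => by
      obtain ⟨x, hx⟩ := hp (g b)
      refine ⟨(x, ⟨b - l x, by simp [hl', hx]⟩), by simp⟩)
    (b0.coprod a) (by
      rintro ⟨x, k⟩ hx
      simp only [LinearMap.coprod_apply, Submodule.subtype_apply] at hx ⊢
      have hk : (k : B) = - l x := by rw [eq_neg_iff_add_eq_zero, add_comm]; exact hx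
      have hpx : p x = 0 := by
        rw [← hl', ← neg_neg (l x), ← hk, map_neg]; simp
      rw [hb0' x hpx, ← map_add]
      convert map_zero a
      ext; simp [hx])
  refine ⟨θ, fun k => ?_⟩
  have := hθ (0, k)
  simpa using this

lemma E1.dual (h : E1 R M) {i : K →ₗ[R] B} {g : B →ₗ[R] M} (hs : SE i g) : DualSurj i := by
  intro a
  obtain ⟨θ, hθ⟩ := lift_inj i hs.inj (LinearMap.ker g).subtype (fun n => hs.ex _ n.2)
  obtain ⟨b, hb⟩ := h B g hs.surj (a ∘ₗ θ)
  refine ⟨b, fun m => ?_⟩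
  have := hb ⟨i m, hs.zero m⟩
  have h2 : θ ⟨i m, hs.zero m⟩ = m := hs.inj (hθ _)
  simpa [h2] using this

lemma E1_quot {i : K →ₗ[R] B} {g : B →ₗ[R] M} (hs : SE i g) (hB : E1 R B) (hi : DualSurj i) :
    E1 R M := by
  obtain ⟨F, _, _, p, _, hp⟩ := exists_cover R B
  have : Module.Projective R F := inferInstance
  refine E1_of_proj (g ∘ₗ p) (hs.surj.comp hp) ?_
  intro a
  let inc : LinearMap.ker p →ₗ[R] LinearMap.ker (g ∘ₗ p) :=
    Submodule.inclusion (fun x hx => by simp [LinearMap.mem_ker.1 hx])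
  obtain ⟨b, hb⟩ := hB _ p hp (a ∘ₗ inc)
  obtain ⟨j, hj⟩ := lift_inj i hs.inj (p ∘ₗ (LinearMap.ker (g ∘ₗ p)).subtype)
    (fun n => hs.ex _ n.2)
  obtain ⟨c, hc⟩ := desc j (fun k => by
      obtain ⟨x, hx⟩ := hp (i k)
      refine ⟨⟨x, by simp [hx, hs.zero]⟩, hs.inj ?_⟩
      rw [hj]; exact hx) (a - b ∘ₗ (LinearMap.ker (g ∘ₗ p)).subtype) (by
      intro x hx
      have hx2 : p x = 0 := by
        have := hj x
        rw [hx, map_zero] at this; exact this.symm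
      have := hb ⟨x, hx2⟩
      simp only [LinearMap.sub_apply, LinearMap.comp_apply, Submodule.subtype_apply] at this ⊢
      rw [this, sub_eq_zero]; rfl)
  obtain ⟨c', hc'⟩ := hi c
  refine ⟨b + c' ∘ₗ p, fun x => ?_⟩
  have h1 := hc x
  have h2 := hj x
  simp only [LinearMap.sub_apply, LinearMap.comp_apply, Submodule.subtype_apply,
    LinearMap.add_apply] at h1 h2 ⊢
  rw [← h2, hc', h1]; abel

lemma E1_projective [Module.Projective R P] : E1 R P := by
  refine E1_of_proj (LinearMap.id : P →ₗ[R] P) Function.surjective_id ?_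
  intro a
  refine ⟨0, fun m => ?_⟩
  have : m = 0 := Subtype.ext m.2
  subst this
  exact (map_zero a).symm

lemma E1_cosyz [Module.Projective R P] (f : M →ₗ[R] P) (hf : DualSurj f) :
    E1 R (P ⧸ LinearMap.range f) := by
  refine E1_quot (SE.ofSub (LinearMap.range f)) E1_projective ?_
  intro a
  obtain ⟨b, hb⟩ := hf (a ∘ₗ f.rangeRestrict)
  refine ⟨b, ?_⟩
  rintro ⟨_, m, rfl⟩
  exact hb m

lemma E1_pi {n : ℕ} (h : E1 R M) : E1 R (Fin n → M) := by
  obtain ⟨F, _, _, p, _, hp⟩ := exists_cover R M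
  have : Module.Free R (Fin n → F) := inferInstance
  have : Module.Projective R (Fin n → F) := inferInstance
  refine E1_of_proj (P := Fin n → F) (LinearMap.pi (fun i => p ∘ₗ LinearMap.proj i))
    (fun v => ?_) ?_
  · choose w hw using fun i => hp (v i)
    exact ⟨w, funext hw⟩
  · intro a
    let s : Fin n → (LinearMap.ker p →ₗ[R] _) := fun i =>
      (LinearMap.single R (fun _ => F) i ∘ₗ (LinearMap.ker p).subtype).codRestrict
        (LinearMap.ker (LinearMap.pi (fun i => p ∘ₗ LinearMap.proj i) :
          (Fin n → F) →ₗ[R] _)) (by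
        intro c
        rw [LinearMap.mem_ker]
        ext j
        by_cases hj : j = i
        · subst hj; simp
        · simp [hj])
    choose b hb using fun i => h _ p hp (a ∘ₗ s i)
    refine ⟨∑ i, b i ∘ₗ LinearMap.proj i, ?_⟩
    rintro ⟨v, hv⟩
    have hv' : ∀ i, p (v i) = 0 := fun i => congrFun hv i
    simp only [LinearMap.sum_apply, LinearMap.comp_apply, LinearMap.proj_apply,
      Submodule.subtype_apply]
    have : ∀ i, b i (v i) = a (s i ⟨v i, hv' i⟩) := fun i => hb i ⟨v i, hv' i⟩
    simp_rw [this]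
    rw [← map_sum]
    congr 1
    ext1
    simp only [AddSubmonoidClass.coe_finsetSum]
    exact Finset.univ_sum_single v

lemma desc_single {n : ℕ} (b : (Fin n → R) →ₗ[R] R) (v : Fin n → R) :
    b v = ∑ i, v i * b (Pi.single i 1) := by
  conv_lhs => rw [← Finset.univ_sum_single v]
  rw [map_sum]
  refine Finset.sum_congr rfl (fun i _ => ?_)
  rw [← smul_eq_mul, ← map_smul, ← Pi.single_smul]; simp

lemma DualSurj.pi {n : ℕ} {f : M →ₗ[R] P} (hf : DualSurj f) (a : M →ₗ[R] (Fin n → R)) :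
    ∃ b : P →ₗ[R] (Fin n → R), ∀ m, b (f m) = a m := by
  choose b hb using fun i => hf (LinearMap.proj i ∘ₗ a)
  exact ⟨LinearMap.pi b, fun m => funext fun i => hb i m⟩

lemma DualSurj.proj [Module.Finite R N] [Module.Projective R N] {f : M →ₗ[R] P}
    (hf : DualSurj f) (a : M →ₗ[R] N) : ∃ b : P →ₗ[R] N, b.comp f = a := by
  obtain ⟨n, p, hp⟩ := Module.Finite.exists_fin' R N
  obtain ⟨l, hl⟩ := Module.projective_lifting_property p LinearMap.id hp
  obtain ⟨b, hb⟩ := hf.pi (l ∘ₗ a)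
  refine ⟨p ∘ₗ b, LinearMap.ext fun m => ?_⟩
  simp only [LinearMap.comp_apply, hb]
  exact LinearMap.congr_fun hl (a m)

lemma DualSurj.ker {f : M →ₗ[R] P} (hf : DualSurj f) {m : M} (hm : f m = 0) :
    m ∈ tt R M := by
  rw [mem_tt]; intro a
  obtain ⟨b, hb⟩ := hf a
  rw [← hb, hm, map_zero]

lemma DualSurj.inj {f : M →ₗ[R] P} (hf : DualSurj f) (h : TL R M) : Function.Injective f := by
  rw [← LinearMap.ker_eq_bot, LinearMap.ker_eq_bot']
  intro m hm
  exact h m ((mem_tt m).1 (hf.ker hm))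

lemma TL_pi {n : ℕ} : TL R (Fin n → R) :=
  fun m h => funext fun i => h (LinearMap.proj i)

lemma TL_of_inj (f : M →ₗ[R] N) (hf : Function.Injective f) (h : TL R N) : TL R M := by
  intro m hm
  apply hf
  rw [map_zero]
  exact h _ (fun a => hm (a ∘ₗ f))

lemma exists_approx [IsNoetherianRing R] [Module.Finite R M] :
    ∃ (n : ℕ) (f : M →ₗ[R] (Fin n → R)), DualSurj f := by
  obtain ⟨k, p, hp⟩ := Module.Finite.exists_fin' R M
  have : Module.Finite R (M →ₗ[R] R) := by
    refine Module.Finite.of_injective (LinearMap.lcomp R R p : (M →ₗ[R] R) →ₗ[R] _) ?_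
    intro a b hab
    ext m
    obtain ⟨x, rfl⟩ := hp m
    exact LinearMap.congr_fun hab x
  obtain ⟨n, q, hq⟩ := Module.Finite.exists_fin' R (M →ₗ[R] R)
  refine ⟨n, LinearMap.pi (fun i => q (Pi.single i 1)), fun a => ?_⟩
  obtain ⟨c, rfl⟩ := hq a
  refine ⟨∑ i, c i • LinearMap.proj i, fun m => ?_⟩
  conv_rhs => rw [← Finset.univ_sum_single c]
  have : ∀ i, (Pi.single i (c i) : Fin n → R) = c i • Pi.single i 1 := by
    intro i; rw [← Pi.single_smul]; simp
  simp_rw [this]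
  simp

end basics
end S16

namespace S16

/-- unbundled resolving subcategory closed under cosyzygies -/
structure RC (R : Type) [CommRing R]
    (X : ∀ (M : Type) [AddCommGroup M] [Module R M], Prop) : Prop where
  fin : ∀ (M : Type) [AddCommGroup M] [Module R M], X M → Module.Finite R M
  free : ∀ n : ℕ, X (Fin n → R)
  summand : ∀ {M N : Type} [AddCommGroup M] [Module R M] [AddCommGroup N] [Module R N]
    (i : N →ₗ[R] M) (r : M →ₗ[R] N), (∀ n, r (i n) = n) → X M → X N
  ext : ∀ {K B M : Type} [AddCommGroup K] [Module R K] [AddCommGroup B] [Module R B]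
    [AddCommGroup M] [Module R M] {i : K →ₗ[R] B} {g : B →ₗ[R] M}, SE i g → X K → X M → X B
  ker : ∀ {K B M : Type} [AddCommGroup K] [Module R K] [AddCommGroup B] [Module R B]
    [AddCommGroup M] [Module R M] {i : K →ₗ[R] B} {g : B →ₗ[R] M}, SE i g → X B → X M → X K
  cosyz : ∀ {M : Type} [AddCommGroup M] [Module R M] {n : ℕ} (f : M →ₗ[R] (Fin n → R)),
    DualSurj f → X M → X ((Fin n → R) ⧸ LinearMap.range f)

section closure
variable {R : Type} [CommRing R] {X : ∀ (M : Type) [AddCommGroup M] [Module R M], Prop}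
variable {K B M N P A : Type} [AddCommGroup K] [Module R K] [AddCommGroup B] [Module R B]
    [AddCommGroup M] [Module R M] [AddCommGroup N] [Module R N] [AddCommGroup P] [Module R P]
    [AddCommGroup A] [Module R A]

lemma RC.iso (h : RC R X) (e : M ≃ₗ[R] N) (hM : X M) : X N :=
  h.summand e.symm.toLinearMap e.toLinearMap (fun n => by simp) hM

lemma SE.prod : SE (LinearMap.inl R M N) (LinearMap.snd R M N) :=
  ⟨LinearMap.inl_injective, LinearMap.snd_surjective, fun k => by simp,
    fun b hb => ⟨b.1, Prod.ext rfl hb.symm⟩⟩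

lemma RC.prod (h : RC R X) (hM : X M) (hN : X N) : X (M × N) := h.ext SE.prod hM hN

lemma RC.pi (h : RC R X) (hM : X M) : ∀ n : ℕ, X (Fin n → M)
  | 0 => h.summand (M := Fin 0 → R) (0 : (Fin 0 → M) →ₗ[R] (Fin 0 → R)) 0
      (fun n => Subsingleton.elim _ _) (h.free 0)
  | n + 1 => by
    refine h.ext (i := LinearMap.single R (fun _ : Fin (n+1) => M) 0)
      (g := LinearMap.funLeft R M (Fin.succ : Fin n → Fin (n+1))) ⟨?_, ?_, ?_, ?_⟩ hM (h.pi hM n)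
    · exact Pi.single_injective (M := fun _ : Fin (n+1) => M) 0
    · exact LinearMap.funLeft_surjective_of_injective _ _ _ (Fin.succ_injective n)
    · intro k
      ext j
      simp [LinearMap.funLeft_apply]
    · intro b hb
      refine ⟨b 0, funext fun j => ?_⟩
      refine Fin.cases ?_ (fun j => ?_) j
      · simp
      · have := congrFun hb j
        simp [LinearMap.funLeft_apply] at this
        simp [this]

/-- kernels of surjections between modules in `X` -/
lemma RC.kerS (h : RC R X) (g : B →ₗ[R] M) (hg : Function.Surjective g) (hB : X B) (hM : X M) :
    X (LinearMap.ker g) := h.ker (SE.ofSurj g hg) hB hM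

lemma RC.range [IsNoetherianRing R] (h : RC R X) {n : ℕ} (f : M →ₗ[R] (Fin n → R))
    (hf : DualSurj f) (hM : X M) :
    X (LinearMap.range f) :=
  h.ker (SE.ofSub (LinearMap.range f)) (h.free n) (h.cosyz f hf hM)

lemma RC.tt [IsNoetherianRing R] (h : RC R X) (hM : X M) : X (tt R M) := by
  have := h.fin M hM
  obtain ⟨n, f, hf⟩ := exists_approx (R := R) (M := M)
  have h1 := h.range f hf hM
  have h2 := h.kerS f.rangeRestrict f.surjective_rangeRestrict hM h1
  have : LinearMap.ker f.rangeRestrict = S16.tt R M := by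
    ext m
    rw [LinearMap.ker_rangeRestrict, LinearMap.mem_ker]
    refine ⟨fun hm => hf.ker hm, fun hm => ?_⟩
    rw [mem_tt] at hm
    exact TL_pi _ (fun a => hm (a ∘ₗ f))
  rw [this] at h2
  exact h2

lemma RC.quot_tt [IsNoetherianRing R] (h : RC R X) (hM : X M) : X (M ⧸ S16.tt R M) := by
  have := h.fin M hM
  obtain ⟨n, f, hf⟩ := exists_approx (R := R) (M := M)
  have h1 := h.range f hf hM
  have : LinearMap.ker f = S16.tt R M := by
    ext m
    refine ⟨fun hm => hf.ker hm, fun hm => ?_⟩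
    rw [mem_tt] at hm
    exact TL_pi _ (fun a => hm (a ∘ₗ f))
  rw [← this]
  exact h.iso f.quotKerEquivRange.symm h1

/-- `V` has a first syzygy in `X` -/
def Yc (X : ∀ (M : Type) [AddCommGroup M] [Module R M], Prop)
    (V : Type) [AddCommGroup V] [Module R V] : Prop :=
  ∃ (n : ℕ) (p : (Fin n → R) →ₗ[R] V), Function.Surjective p ∧ X (LinearMap.ker p)

lemma RC.yc (h : RC R X) (hM : X M) : Yc X M := by
  have := h.fin M hM
  obtain ⟨n, p, hp⟩ := Module.Finite.exists_fin' R M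
  exact ⟨n, p, hp, h.kerS p hp (h.free n) hM⟩

/-- the cocone map -/
def cc {n : ℕ} (p : (Fin n → R) →ₗ[R] M) (φ : A →ₗ[R] M) : ((Fin n → R) × A) →ₗ[R] M :=
  p ∘ₗ LinearMap.fst R _ _ - φ ∘ₗ LinearMap.snd R _ _

@[simp] lemma cc_apply {n : ℕ} (p : (Fin n → R) →ₗ[R] M) (φ : A →ₗ[R] M) (x : (Fin n → R) × A) :
    cc p φ x = p x.1 - φ x.2 := rfl

lemma RC.cone (h : RC R X) {n : ℕ} (p : (Fin n → R) →ₗ[R] M) (hp : Function.Surjective p)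
    (φ : A →ₗ[R] M) (hA : X A) (hM : X M) : X (LinearMap.ker (cc p φ)) := by
  refine h.kerS _ (fun m => ?_) (h.prod (h.free n) hA) hM
  obtain ⟨x, hx⟩ := hp m
  exact ⟨(x, 0), by simp [hx]⟩

/-- universal extension -/
lemma RC.univ [IsNoetherianRing R] (h : RC R X) (hV : Yc X M) :
    ∃ (n : ℕ) (E : Type) (_ : AddCommGroup E) (_ : Module R E)
      (i : (Fin n → R) →ₗ[R] E) (g : E →ₗ[R] M), SE i g ∧ X E ∧ E1 R E := by
  obtain ⟨k, p, hp, hK⟩ := hV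
  have := h.fin _ hK
  obtain ⟨n, j, hj⟩ := exists_approx (R := R) (M := LinearMap.ker p)
  let u : LinearMap.ker p →ₗ[R] (Fin k → R) × (Fin n → R) :=
    (LinearMap.ker p).subtype.prod j
  have hu : DualSurj u := by
    intro a
    obtain ⟨b, hb⟩ := hj a
    exact ⟨b ∘ₗ LinearMap.snd R _ _, fun m => hb m⟩
  let e : ((Fin k → R) × (Fin n → R)) ≃ₗ[R] (Fin (k + n) → R) :=
    (LinearEquiv.sumArrowLequivProdArrow (Fin k) (Fin n) R R).symm.trans
      (LinearEquiv.funCongrLeft R R finSumFinEquiv.symm)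
  let g0 : ((Fin k → R) × (Fin n → R)) →ₗ[R] M := p ∘ₗ LinearMap.fst R _ _
  have hu' : DualSurj (e.toLinearMap ∘ₗ u) := by
    intro a
    obtain ⟨b, hb⟩ := hu a
    exact ⟨b ∘ₗ e.symm.toLinearMap, fun m => by simp [hb]⟩
  have hX := h.cosyz (e.toLinearMap ∘ₗ u) hu' hK
  have hE : E1 R (((Fin k → R) × (Fin n → R)) ⧸ LinearMap.range u) := E1_cosyz u hu
  have hX2 : X (((Fin k → R) × (Fin n → R)) ⧸ LinearMap.range u) := by
    refine h.iso ?_ hX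
    refine (Submodule.Quotient.equiv _ _ e ?_).symm
    rw [LinearMap.range_comp]
  refine ⟨n, ((Fin k → R) × (Fin n → R)) ⧸ LinearMap.range u, inferInstance, inferInstance,
    (LinearMap.range u).mkQ ∘ₗ LinearMap.inr R _ _, (LinearMap.range u).liftQ g0 ?_,
    ⟨?_, ?_, ?_, ?_⟩, hX2, hE⟩
  · rintro _ ⟨x, rfl⟩
    exact x.2
  · rw [← LinearMap.ker_eq_bot, LinearMap.ker_eq_bot']
    intro q hq
    have : ((0 : Fin k → R), q) ∈ LinearMap.range u := by simpa using hq
    obtain ⟨x, hx⟩ := this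
    have hx0 : x = 0 := Subtype.ext (congrArg Prod.fst hx)
    subst hx0
    have := congrArg Prod.snd hx
    simp at this
    exact this.symm
  · intro m
    obtain ⟨x, hx⟩ := hp m
    exact ⟨Submodule.Quotient.mk (x, 0), hx⟩
  · intro q
    simp [g0]
  · intro b
    obtain ⟨⟨x, q⟩, rfl⟩ := Submodule.mkQ_surjective _ b
    intro hb
    have hx : p x = 0 := hb
    refine ⟨q - j ⟨x, hx⟩, ?_⟩
    simp only [LinearMap.comp_apply, Submodule.mkQ_apply]
    rw [Submodule.Quotient.eq]
    refine ⟨-⟨x, hx⟩, ?_⟩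
    simp [u]

lemma SE.retract {n : ℕ} {i : (Fin n → R) →ₗ[R] B} {g : B →ₗ[R] M} (hs : SE i g)
    (hi : DualSurj i) : ∃ (r : B →ₗ[R] (Fin n → R)) (s : M →ₗ[R] B), (∀ x, r (i x) = x) ∧
      (∀ m, g (s m) = m) ∧ (∀ b, s (g b) = b - i (r b)) := by
  obtain ⟨r, hr⟩ := hi.pi LinearMap.id
  obtain ⟨s, hs'⟩ := desc g hs.surj (LinearMap.id - i ∘ₗ r) (by
    intro b hb
    obtain ⟨k, rfl⟩ := hs.ex b hb
    simp [hr])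
  refine ⟨r, s, hr, fun m => ?_, fun b => hs' b⟩
  obtain ⟨b, rfl⟩ := hs.surj m
  rw [hs']
  simp [hs.zero]

lemma RC.of_yc [IsNoetherianRing R] (h : RC R X) (hV : Yc X M) (hE : E1 R M) : X M := by
  obtain ⟨n, E, _, _, i, g, hs, hX, _⟩ := h.univ hV
  obtain ⟨r, s, _, h2, _⟩ := hs.retract (hE.dual hs)
  exact h.summand s g h2 hX

variable [IsLocalRing R]

open IsLocalRing in
lemma RC.of_killed (h : RC R X) (hM : X M) (hm : ∀ x ∈ maximalIdeal R, ∀ t : M, x • t = 0)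
    {t : M} (ht : t ≠ 0) : X (ResidueField R) := by
  have htors : Module.IsTorsionBySet R M (maximalIdeal R : Set R) := by
    intro t x
    exact hm _ x.2 t
  let : Module (ResidueField R) M := htors.module
  have htow : ∀ (r : R) (m : M), (residue R r) • m = r • m := fun r m => rfl
  obtain ⟨f, hf⟩ := Module.Projective.exists_dual_ne_zero (ResidueField R) ht
  let f' : M →ₗ[R] ResidueField R :=
    { toFun := fun m => (f t)⁻¹ * f m
      map_add' := fun a b => by simp [mul_add]
      map_smul' := fun r a => by
        rw [← htow, map_smul, smul_eq_mul, RingHom.id_apply, Algebra.smul_def]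
        change _ * (residue R r * _) = residue R r * _
        ring }
  let i : ResidueField R →ₗ[R] M :=
    { toFun := fun c => c • t
      map_add' := fun a b => add_smul a b t
      map_smul' := fun r a => by
        rw [Algebra.smul_def, mul_smul]; rfl }
  refine h.summand i f' (fun c => ?_) hM
  change (f t)⁻¹ * f (c • t) = c
  rw [map_smul, smul_eq_mul]
  field_simp

open IsLocalRing in
lemma RC.socle_tt [IsNoetherianRing R] (h : RC R X) (hN : X N) (hE : E1 R N) {s : N}
    (hst : s ∈ S16.tt R N) (hs0 : s ≠ 0) (hs : ∀ x ∈ maximalIdeal R, x • s = 0) :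
    X (ResidueField R) := by
  obtain ⟨n, x, hx⟩ := Submodule.fg_iff_exists_fin_generating_family.1
    (IsNoetherian.noetherian (maximalIdeal R))
  have hxm : ∀ i, x i ∈ maximalIdeal R := fun i => by
    rw [← hx]; exact Submodule.subset_span ⟨i, rfl⟩
  have hkill : ∀ {M : Type} [AddCommGroup M] [Module R M] (t : M), (∀ i, x i • t = 0) →
      ∀ y ∈ maximalIdeal R, y • t = 0 := by
    intro M _ _ t ht y hy
    rw [← hx] at hy
    have : Submodule.span R (Set.range x) ≤ LinearMap.ker (LinearMap.toSpanSingleton R M t) := by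
      rw [Submodule.span_le]
      rintro _ ⟨i, rfl⟩
      exact ht i
    exact this hy
  let φ : N →ₗ[R] (Fin n → N) := LinearMap.pi (fun i => x i • LinearMap.id)
  have hNn : X (Fin n → N) := h.pi hN n
  have := h.fin _ hNn
  obtain ⟨k, p, hp⟩ := Module.Finite.exists_fin' R (Fin n → N)
  have hL := h.cone p hp φ hN hNn
  have hT := h.tt hL
  have hφs : φ s = 0 := funext fun i => hs _ (hxm i)
  let σ : LinearMap.ker (cc p φ) := ⟨(0, s), by simp [hφs]⟩
  have hσ : σ ∈ S16.tt R (LinearMap.ker (cc p φ)) := by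
    rw [mem_tt]
    intro θ
    let inc : LinearMap.ker p →ₗ[R] LinearMap.ker (cc p φ) :=
      (LinearMap.inl R _ _ ∘ₗ (LinearMap.ker p).subtype).codRestrict _ (fun c => by simp)
    obtain ⟨b, hb⟩ := E1_pi hE _ p hp (θ ∘ₗ inc)
    obtain ⟨η, hη⟩ := desc (LinearMap.snd R _ _ ∘ₗ (LinearMap.ker (cc p φ)).subtype)
      (fun a => by
        obtain ⟨f, hf⟩ := hp (φ a)
        exact ⟨⟨(f, a), by simp [hf]⟩, rfl⟩)
      (θ - b ∘ₗ LinearMap.fst R _ _ ∘ₗ (LinearMap.ker (cc p φ)).subtype) (by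
        rintro ⟨⟨f, a⟩, hfa⟩ h0
        have ha : a = 0 := h0
        subst ha
        have hf : p f = 0 := by simpa using hfa
        have := hb ⟨f, hf⟩
        simp only [LinearMap.sub_apply, LinearMap.comp_apply, Submodule.subtype_apply,
          LinearMap.fst_apply] at this ⊢
        rw [this, sub_eq_zero]; rfl)
    have h1 := hη σ
    have h2 : η s = 0 := (mem_tt s).1 hst η
    simp only [LinearMap.sub_apply, LinearMap.comp_apply, Submodule.subtype_apply,
          LinearMap.fst_apply, LinearMap.snd_apply, σ, h2, map_zero, sub_zero] at h1
    exact h1.symm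
  refine h.of_killed hT (t := ⟨σ, hσ⟩) ?_ ?_
  · intro y hy t
    refine hkill t (fun i => ?_) y hy
    obtain ⟨⟨⟨f, a⟩, hfa⟩, ht⟩ := t
    rw [mem_tt] at ht
    have hf : f = 0 := TL_pi f (fun b => ht (b ∘ₗ LinearMap.fst R _ _ ∘ₗ
      (LinearMap.ker (cc p φ)).subtype))
    subst hf
    have ha : φ a = 0 := by simpa using hfa
    apply Subtype.ext; apply Subtype.ext
    refine Prod.ext (smul_zero _) (congrFun ha i)
  · intro h0
    apply hs0
    have := congrArg (fun t => t.1.1.2) h0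
    exact this

end closure
end S16

namespace S16

set_option linter.unusedSectionVars false
section loc
open IsLocalRing
variable {R : Type} [CommRing R] [IsNoetherianRing R] [IsLocalRing R]
  {X : ∀ (M : Type) [AddCommGroup M] [Module R M], Prop}
variable {M N D : Type} [AddCommGroup M] [Module R M] [AddCommGroup N] [Module R N]
  [AddCommGroup D] [Module R D]

lemma dichotomy (I : Ideal R) : (∃ z, z ∉ I ∧ ∀ x ∈ maximalIdeal R, x * z ∈ I) ∨
    (∃ y ∈ maximalIdeal R, ∀ r, y * r ∈ I → r ∈ I) := by
  by_cases h : (maximalIdeal R : Set R) ⊆ ⋃ p ∈ associatedPrimes R (R ⧸ I), p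
  · left
    obtain ⟨p, hp, hle⟩ := (Ideal.subset_union_prime_finite (associatedPrimes.finite R (R ⧸ I))
      (f := id) 0 0 (fun p hp _ _ => IsAssociatedPrime.isPrime hp)).1 h
    obtain ⟨hprime, x, hx⟩ := (isAssociatedPrime_iff).1 hp
    obtain ⟨z, rfl⟩ := Ideal.Quotient.mk_surjective x
    have key : ∀ r, r ∈ p ↔ r * z ∈ I := by
      intro r
      rw [hx, Submodule.mem_colon_singleton, Submodule.mem_bot, ← Ideal.Quotient.eq_zero_iff_mem,
        map_mul]
      rfl
    refine ⟨z, fun hz => hprime.ne_top ?_, fun x hx => (key x).1 (hle hx)⟩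
    rw [Ideal.eq_top_iff_one, key]; simpa using hz
  · right
    rw [Set.not_subset] at h
    obtain ⟨y, hy, hy2⟩ := h
    refine ⟨y, hy, fun r hr => ?_⟩
    rw [biUnion_associatedPrimes_eq_zero_divisors] at hy2
    by_contra hrI
    refine hy2 ⟨Ideal.Quotient.mk I r, by rwa [Ne, Ideal.Quotient.eq_zero_iff_mem], ?_⟩
    have : Ideal.Quotient.mk I (y * r) = 0 := by rwa [Ideal.Quotient.eq_zero_iff_mem]
    rw [map_mul] at this
    exact this

lemma lemmaS {a b : ℕ} (h : (Fin a → R) →ₗ[R] (Fin b → R)) :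
    (∃ r : (Fin b → R) →ₗ[R] (Fin a → R), ∀ q, r (h q) = q) ∨
    (∃ q, (∀ j, h q j ∈ maximalIdeal R) ∧ ∃ i, q i ∉ maximalIdeal R) := by
  by_cases hs : Function.Injective (h.lTensor (ResidueField R))
  · left
    obtain ⟨r, hr⟩ := (IsLocalRing.split_injective_iff_lTensor_residueField_injective h).2 hs
    exact ⟨r, fun q => LinearMap.congr_fun hr q⟩
  · right
    rw [← LinearMap.ker_eq_bot, LinearMap.ker_eq_bot'] at hs
    push Not at hs
    obtain ⟨x, hx, hx0⟩ := hs
    have hsur : ∃ q : Fin a → R, TensorProduct.tmul R (1 : ResidueField R) q = x := by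
      induction x using TensorProduct.induction_on with
      | zero => exact ⟨0, by simp⟩
      | tmul c v =>
        obtain ⟨r, rfl⟩ := residue_surjective c
        refine ⟨r • v, ?_⟩
        rw [← TensorProduct.smul_tmul, Algebra.smul_def, mul_one]; rfl
      | add u v hu hv =>
        have key : ∀ w : TensorProduct R (ResidueField R) (Fin a → R), ∃ q : Fin a → R,
            TensorProduct.tmul R (1 : ResidueField R) q = w := by
          intro w
          induction w using TensorProduct.induction_on with
          | zero => exact ⟨0, by simp⟩
          | tmul c v =>
            obtain ⟨r, rfl⟩ := residue_surjective c
            refine ⟨r • v, ?_⟩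
            rw [← TensorProduct.smul_tmul, Algebra.smul_def, mul_one]; rfl
          | add u v hu hv =>
            obtain ⟨p, rfl⟩ := hu
            obtain ⟨q, rfl⟩ := hv
            exact ⟨p + q, TensorProduct.tmul_add _ _ _⟩
        exact key _
    obtain ⟨q, rfl⟩ := hsur
    refine ⟨q, fun j => ?_, ?_⟩
    · rw [LinearMap.lTensor_tmul] at hx
      have := congrArg (fun w => TensorProduct.rid R _
        ((LinearMap.proj j : (Fin b → R) →ₗ[R] R).lTensor (ResidueField R) w)) hx
      simp only [LinearMap.lTensor_tmul, map_zero, TensorProduct.rid_tmul,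
        LinearMap.proj_apply, Algebra.smul_def, mul_one] at this
      rw [← residue_eq_zero_iff]
      exact this
    · by_contra hq
      push Not at hq
      apply hx0
      rw [← Finset.univ_sum_single q, TensorProduct.tmul_sum]
      refine Finset.sum_eq_zero (fun i _ => ?_)
      have : (Pi.single i (q i) : Fin a → R) = q i • Pi.single i 1 := by
        rw [← Pi.single_smul]; simp
      rw [this, ← TensorProduct.smul_tmul, Algebra.smul_def, mul_one]
      have h2 : residue R (q i) = 0 := (residue_eq_zero_iff _).2 (hq i)
      have h3 : algebraMap R (ResidueField R) (q i) = 0 := h2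
      rw [h3, TensorProduct.zero_tmul]

lemma exists_gens (R : Type) [CommRing R] [IsNoetherianRing R] [IsLocalRing R] :
    ∃ (n : ℕ) (x : Fin n → R), Submodule.span R (Set.range x) = maximalIdeal R :=
  Submodule.fg_iff_exists_fin_generating_family.1 (IsNoetherian.noetherian (maximalIdeal R))

lemma gens_mem {n : ℕ} {x : Fin n → R} (hx : Submodule.span R (Set.range x) = maximalIdeal R)
    (i : Fin n) : x i ∈ maximalIdeal R := by
  rw [← hx]; exact Submodule.subset_span ⟨i, rfl⟩

lemma gens_kill {n : ℕ} {x : Fin n → R} (hx : Submodule.span R (Set.range x) = maximalIdeal R)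
    (t : M) (ht : ∀ i, x i • t = 0) (y : R) (hy : y ∈ maximalIdeal R) : y • t = 0 := by
  rw [← hx] at hy
  have : Submodule.span R (Set.range x) ≤ LinearMap.ker (LinearMap.toSpanSingleton R M t) := by
    rw [Submodule.span_le]
    rintro _ ⟨i, rfl⟩
    exact ht i
  exact this hy

lemma nakayama [Module.Finite R D] {d : D} (hd : d ≠ 0) :
    ∃ t : D, t ∉ (maximalIdeal R • ⊤ : Submodule R D) := by
  by_contra hcon
  push Not at hcon
  have h1 : (⊤ : Submodule R D) ≤ maximalIdeal R • ⊤ := fun t _ => hcon t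
  have h2 := Submodule.eq_bot_of_le_smul_of_le_jacobson_bot (maximalIdeal R) ⊤
    Module.Finite.fg_top h1 (by rw [IsLocalRing.jacobson_eq_maximalIdeal ⊥ bot_ne_top])
  apply hd
  have : d ∈ (⊤ : Submodule R D) := trivial
  rw [h2] at this
  simpa using this

lemma exists_functional {z : R} (hz0 : z ≠ 0) (hz : ∀ x ∈ maximalIdeal R, x * z = 0)
    [Module.Finite R D] {d : D} (hd : d ≠ 0) :
    ∃ l : D →ₗ[R] R, (∃ t, l t ≠ 0) ∧ ∀ x ∈ maximalIdeal R, ∀ d, x * l d = 0 := by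
  obtain ⟨t, ht⟩ := nakayama (R := R) hd
  let V := D ⧸ (maximalIdeal R • ⊤ : Submodule R D)
  let mk : D →ₗ[R] V := (maximalIdeal R • ⊤ : Submodule R D).mkQ
  have htors : Module.IsTorsionBySet R V (maximalIdeal R : Set R) := by
    intro v x
    obtain ⟨d, rfl⟩ := Submodule.mkQ_surjective _ v
    rw [← map_smul]
    change Submodule.Quotient.mk _ = 0
    rw [Submodule.Quotient.mk_eq_zero]
    exact Submodule.smul_mem_smul x.2 trivial
  let _ : Module (ResidueField R) V := htors.module
  have htow : ∀ (r : R) (m : V), (residue R r) • m = r • m := fun r m => rfl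
  have ht0 : mk t ≠ 0 := by
    intro h0
    exact ht ((Submodule.Quotient.mk_eq_zero _).1 h0)
  obtain ⟨f, hf⟩ := Module.Projective.exists_dual_ne_zero (ResidueField R) ht0
  let f' : D →ₗ[R] ResidueField R :=
    { toFun := fun m => f (mk m)
      map_add' := fun a b => by simp
      map_smul' := fun r a => by
        rw [map_smul, ← htow, map_smul, smul_eq_mul, RingHom.id_apply, Algebra.smul_def]
        rfl }
  let κ : ResidueField R →ₗ[R] R :=
    (maximalIdeal R).liftQ (LinearMap.toSpanSingleton R R z) (fun x hx => hz x hx)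
  have hκ : ∀ r, κ (residue R r) = r * z := fun r => rfl
  refine ⟨κ ∘ₗ f', ⟨t, ?_⟩, ?_⟩
  · have hft : f' t ≠ 0 := hf
    obtain ⟨r, hr⟩ := residue_surjective (f' t)
    rw [LinearMap.comp_apply, ← hr, hκ]
    rw [← hr, Ne, residue_eq_zero_iff, mem_maximalIdeal, mem_nonunits_iff, not_not] at hft
    intro h0
    exact hz0 ((hft.mul_right_eq_zero).1 h0)
  · intro x hx d
    obtain ⟨r, hr⟩ := residue_surjective (f' d)
    rw [LinearMap.comp_apply, ← hr, hκ, mul_left_comm, hz x hx, mul_zero]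

lemma dual_finite [Module.Finite R M] : Module.Finite R (M →ₗ[R] R) := by
  obtain ⟨k, p, hp⟩ := Module.Finite.exists_fin' R M
  refine Module.Finite.of_injective (LinearMap.lcomp R R p : (M →ₗ[R] R) →ₗ[R] _) ?_
  intro a b hab
  ext m
  obtain ⟨x, rfl⟩ := hp m
  exact LinearMap.congr_fun hab x

lemma E1_prod {n : ℕ} (h : E1 R M) : E1 R (M × (Fin n → R)) := by
  obtain ⟨F, _, _, p, _, hp⟩ := exists_cover R M
  have : Module.Projective R F := inferInstance
  refine E1_of_proj (P := F × (Fin n → R)) (p.prodMap LinearMap.id)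
    (hp.prodMap Function.surjective_id) ?_
  intro a
  let s : LinearMap.ker p →ₗ[R] LinearMap.ker (p.prodMap (LinearMap.id : (Fin n → R) →ₗ[R] _)) :=
    (LinearMap.inl R _ _ ∘ₗ (LinearMap.ker p).subtype).codRestrict _ (fun c => by simp)
  obtain ⟨b, hb⟩ := h _ p hp (a ∘ₗ s)
  refine ⟨b ∘ₗ LinearMap.fst R _ _, ?_⟩
  rintro ⟨⟨x, q⟩, hx⟩
  have hq : q = 0 := congrArg Prod.snd hx
  subst hq
  exact hb ⟨x, congrArg Prod.fst hx⟩

/-- torsionlessness in depth zero -/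
lemma tau0 (h : RC R X) (hk : ¬ X (ResidueField R)) {z : R} (hz0 : z ≠ 0)
    (hz : ∀ x ∈ maximalIdeal R, x * z = 0) (hN : X N) (hE : E1 R N) : TL R N := by
  by_contra hTL
  unfold TL at hTL
  push Not at hTL
  obtain ⟨s, hs, hs0⟩ := hTL
  apply hk
  have hT := h.tt hN
  have := h.fin _ hT
  have hst : (⟨s, (mem_tt s).2 hs⟩ : tt R N) ≠ 0 := fun h0 => hs0 (congrArg Subtype.val h0)
  obtain ⟨l0, ⟨t0, ht0⟩, -⟩ := exists_functional hz0 hz hst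
  have hl0 : l0 ≠ 0 := fun h0 => ht0 (by simp [h0])
  have := dual_finite (R := R) (M := tt R N)
  obtain ⟨l, ⟨a0, ha0⟩, hl⟩ := exists_functional hz0 hz hl0
  obtain ⟨n, f, hf⟩ := exists_approx (R := R) (M := tt R N)
  let q : Fin n → R := fun i => l (LinearMap.proj i ∘ₗ f)
  have hbq : ∀ b : (Fin n → R) →ₗ[R] R, b q = l (b ∘ₗ f) := by
    intro b
    rw [desc_single]
    have : b ∘ₗ f = ∑ i, b (Pi.single i 1) • (LinearMap.proj i ∘ₗ f) := by
      ext t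
      rw [LinearMap.comp_apply, desc_single]
      simp [mul_comm]
    rw [this, map_sum]
    refine Finset.sum_congr rfl (fun i _ => ?_)
    rw [map_smul, smul_eq_mul, mul_comm]
  have hq0 : q ≠ 0 := by
    intro h0
    apply ha0
    obtain ⟨b, hb⟩ := hf a0
    have : a0 = b ∘ₗ f := by ext t; exact (hb t).symm
    rw [this, ← hbq, h0, map_zero]
  let u : tt R N →ₗ[R] N × (Fin n → R) := (tt R N).subtype.prod f
  have hu : DualSurj u := by
    intro a
    obtain ⟨b, hb⟩ := hf a
    exact ⟨b ∘ₗ LinearMap.snd R _ _, fun m => hb m⟩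
  have hui : Function.Injective u := fun a b hab => Subtype.ext (congrArg Prod.fst hab)
  have hE1 := E1_quot (SE.ofInj u hui) (E1_prod hE) hu
  have hXE : X ((N × (Fin n → R)) ⧸ LinearMap.range u) := by
    refine h.ext (i := (LinearMap.range u).mkQ ∘ₗ LinearMap.inr R _ _)
      (g := (LinearMap.range u).liftQ ((tt R N).mkQ ∘ₗ LinearMap.fst R _ _) ?_)
      ⟨?_, ?_, ?_, ?_⟩ (h.free n) (h.quot_tt hN)
    · rintro _ ⟨x, rfl⟩
      simp [u]
    · rw [← LinearMap.ker_eq_bot, LinearMap.ker_eq_bot']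
      intro q hq
      have : ((0 : N), q) ∈ LinearMap.range u := by simpa using hq
      obtain ⟨x, hx⟩ := this
      have hx0 : x = 0 := Subtype.ext (congrArg Prod.fst hx)
      subst hx0
      have := congrArg Prod.snd hx
      simp at this
      exact this.symm
    · intro m
      obtain ⟨x, hx⟩ := Submodule.mkQ_surjective _ m
      exact ⟨Submodule.Quotient.mk (x, 0), hx⟩
    · intro q
      simp
    · intro b
      obtain ⟨⟨x, q⟩, rfl⟩ := Submodule.mkQ_surjective _ b
      intro hb
      have hx : x ∈ tt R N := by simpa using hb
      refine ⟨q - f ⟨x, hx⟩, ?_⟩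
      simp only [LinearMap.comp_apply, Submodule.mkQ_apply]
      rw [Submodule.Quotient.eq]
      refine ⟨-⟨x, hx⟩, ?_⟩
      simp [u]
  refine h.socle_tt hXE hE1 (s := Submodule.Quotient.mk ((0 : N), q)) ?_ ?_ ?_
  · rw [mem_tt]
    intro θ
    have h1 : ∀ t, θ (Submodule.Quotient.mk ((0 : N), f t)) = 0 := by
      intro t
      have e1 : θ (Submodule.Quotient.mk ((t : N), f t)) = 0 := by
        have e0 : (u t) ∈ LinearMap.range u := ⟨t, rfl⟩
        have e0' := (Submodule.Quotient.mk_eq_zero _).2 e0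
        exact (congrArg θ e0').trans (map_zero θ)
      have e2 : θ (Submodule.Quotient.mk ((t : N), (0 : Fin n → R))) = 0 :=
        (mem_tt _).1 t.2 (θ ∘ₗ (LinearMap.range u).mkQ ∘ₗ LinearMap.inl R _ _)
      have e3 : (((t : N), f t) : N × (Fin n → R)) = ((t : N), 0) + (0, f t) := by simp
      rw [e3, Submodule.Quotient.mk_add, map_add, e2, zero_add] at e1
      exact e1
    have h2 := hbq (θ ∘ₗ (LinearMap.range u).mkQ ∘ₗ LinearMap.inr R _ _)
    have h3 : (θ ∘ₗ (LinearMap.range u).mkQ ∘ₗ LinearMap.inr R _ _) ∘ₗ f = 0 := by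
      ext t; exact h1 t
    rw [h3, map_zero] at h2
    exact h2
  · rw [Ne, Submodule.Quotient.mk_eq_zero]
    rintro ⟨x, hx⟩
    have hx0 : x = 0 := Subtype.ext (congrArg Prod.fst hx)
    subst hx0
    have := congrArg Prod.snd hx
    simp at this
    exact hq0 this.symm
  · intro x hx
    rw [← Submodule.Quotient.mk_smul]
    have : x • ((0 : N), q) = 0 := by
      refine Prod.ext (smul_zero _) (funext fun i => ?_)
      exact hl x hx _
    rw [this, Submodule.Quotient.mk_zero]

end loc
end S16

namespace S16

set_option linter.unusedSectionVars false
section pos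
open IsLocalRing
variable {R : Type} [CommRing R] [IsNoetherianRing R] [IsLocalRing R]
  {X : ∀ (M : Type) [AddCommGroup M] [Module R M], Prop}
variable {A M N D V E : Type} [AddCommGroup M] [Module R M] [AddCommGroup N] [Module R N]
  [AddCommGroup D] [Module R D] [AddCommGroup A] [Module R A] [AddCommGroup V] [Module R V]
  [AddCommGroup E] [Module R E]

section cone
variable {y : R}

lemma tt_cone (hy : ∀ r : R, y * r = 0 → r = 0)
    {n : ℕ} (p : (Fin n → R) →ₗ[R] M) (φ : A →ₗ[R] M) (hφ : ∀ a, φ a = 0 → y • a = 0)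
    (l : LinearMap.ker (cc p φ)) : l ∈ tt R (LinearMap.ker (cc p φ)) ↔ l.1.1 = 0 := by
  rw [mem_tt]
  constructor
  · intro h
    exact TL_pi _ (fun b => h (b ∘ₗ LinearMap.fst R _ _ ∘ₗ (LinearMap.ker (cc p φ)).subtype))
  · intro h θ
    apply hy
    rw [← smul_eq_mul, ← map_smul]
    have : y • l = 0 := by
      have h2 := l.2
      rw [LinearMap.mem_ker, cc_apply, h, map_zero, zero_sub, neg_eq_zero] at h2
      apply Subtype.ext
      refine Prod.ext ?_ (hφ _ h2)
      change y • l.1.1 = 0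
      rw [h, smul_zero]
    rw [this, map_zero]

lemma RC.coneKer (hy : ∀ r : R, y * r = 0 → r = 0)
    (h : RC R X) (φ : A →ₗ[R] M) (hA : X A) (hM : X M)
    (hφ : ∀ a, φ a = 0 → y • a = 0) : X (LinearMap.ker φ) := by
  have := h.fin M hM
  obtain ⟨n, p, hp⟩ := Module.Finite.exists_fin' R M
  have hL := h.tt (h.cone p hp φ hA hM)
  let i0 : LinearMap.ker φ →ₗ[R] LinearMap.ker (cc p φ) :=
    (LinearMap.inr R _ _ ∘ₗ (LinearMap.ker φ).subtype).codRestrict _ (fun c => by simp)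
  let i : LinearMap.ker φ →ₗ[R] S16.tt R (LinearMap.ker (cc p φ)) :=
    i0.codRestrict _ (fun c => (tt_cone hy p φ hφ _).2 rfl)
  let r : S16.tt R (LinearMap.ker (cc p φ)) →ₗ[R] LinearMap.ker φ :=
    (LinearMap.snd R _ _ ∘ₗ (LinearMap.ker (cc p φ)).subtype ∘ₗ
      (S16.tt R (LinearMap.ker (cc p φ))).subtype).codRestrict _ (fun c => by
        have h1 := (tt_cone hy p φ hφ _).1 c.2
        have h2 := c.1.2
        rw [LinearMap.mem_ker, cc_apply, h1, map_zero, zero_sub, neg_eq_zero] at h2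
        exact h2)
  exact h.summand i r (fun _ => rfl) hL

lemma RC.coneQuot (hy : ∀ r : R, y * r = 0 → r = 0)
    (h : RC R X) (φ : A →ₗ[R] M) (hA : X A) (hM : X M)
    (hφ : ∀ a, φ a = 0 → y • a = 0) : Yc X (M ⧸ LinearMap.range φ) := by
  have := h.fin M hM
  obtain ⟨n, p, hp⟩ := Module.Finite.exists_fin' R M
  have hL := h.quot_tt (h.cone p hp φ hA hM)
  refine ⟨n, (LinearMap.range φ).mkQ ∘ₗ p, (Submodule.mkQ_surjective _).comp hp, ?_⟩
  let g : LinearMap.ker (cc p φ) →ₗ[R] LinearMap.ker ((LinearMap.range φ).mkQ ∘ₗ p) :=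
    (LinearMap.fst R _ _ ∘ₗ (LinearMap.ker (cc p φ)).subtype).codRestrict _ (fun c => by
      have h2 := c.2
      rw [LinearMap.mem_ker, cc_apply, sub_eq_zero] at h2
      simp [h2])
  have hg : Function.Surjective g := by
    rintro ⟨f, hf⟩
    have : p f ∈ LinearMap.range φ := by simpa using hf
    obtain ⟨a, ha⟩ := this
    exact ⟨⟨(f, a), by simp [ha]⟩, rfl⟩
  have hker : LinearMap.ker g = S16.tt R (LinearMap.ker (cc p φ)) := by
    ext l
    rw [tt_cone hy p φ hφ, LinearMap.mem_ker]
    exact ⟨fun h0 => congrArg Subtype.val h0, fun h0 => Subtype.ext h0⟩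
  rw [← hker] at hL
  exact h.iso (g.quotKerEquivOfSurjective hg) hL

end cone

variable {y : R}

lemma RC.socle (hym : y ∈ maximalIdeal R) (hy : ∀ r : R, y * r = 0 → r = 0)
    (h : RC R X) (hM : X M) {s : M} (hs0 : s ≠ 0)
    (hs : ∀ x ∈ maximalIdeal R, x • s = 0) : X (ResidueField R) := by
  obtain ⟨n, x, hx⟩ := exists_gens R
  let φ : M →ₗ[R] (Fin n → M) := LinearMap.pi (fun i => x i • LinearMap.id)
  have hφ : ∀ a, φ a = 0 → ∀ y ∈ maximalIdeal R, y • a = 0 := by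
    intro a ha
    exact gens_kill hx a (fun i => congrFun ha i)
  have hT := h.coneKer hy φ hM (h.pi hM n) (fun a ha => hφ a ha y hym)
  refine h.of_killed hT (t := ⟨s, funext fun i => hs _ (gens_mem hx i)⟩) ?_ ?_
  · intro r hr t
    exact Subtype.ext (hφ t.1 t.2 r hr)
  · intro h0; exact hs0 (congrArg Subtype.val h0)

lemma E1_noSocle (hy : ∀ r : R, y * r = 0 → r = 0)
    (hns : ∀ z, (∀ x ∈ maximalIdeal R, ∃ r, x * z = y * r) → ∃ r, z = y * r)
    (hym : y ∈ maximalIdeal R)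
    (hV : ∀ x ∈ maximalIdeal R, ∀ v : V, x • v = 0) : E1 R V := by
  obtain ⟨F, _, _, p, _, hp⟩ := exists_cover R V
  have : Module.Projective R F := inferInstance
  refine E1_of_proj p hp ?_
  intro a
  have hmem : ∀ x ∈ maximalIdeal R, ∀ f, x • f ∈ LinearMap.ker p := by
    intro x hx f
    rw [LinearMap.mem_ker, map_smul, hV x hx]
  let b0 : F →ₗ[R] R := a ∘ₗ ((y • LinearMap.id : F →ₗ[R] F).codRestrict _ (fun f => hmem y hym f))
  have hb0 : ∀ f, b0 f = a ⟨y • f, hmem y hym f⟩ := fun f => rfl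
  obtain ⟨b, hb⟩ := lift_inj (y • LinearMap.id : R →ₗ[R] R) (by
      rw [← LinearMap.ker_eq_bot, LinearMap.ker_eq_bot']
      exact fun m hm => hy m hm) b0 (by
      intro f
      obtain ⟨r, hr⟩ := hns (b0 f) (by
        intro x hx
        refine ⟨a ⟨x • f, hmem x hx f⟩, ?_⟩
        rw [hb0, ← smul_eq_mul, ← smul_eq_mul, ← map_smul, ← map_smul]
        congr 1
        exact Subtype.ext (smul_comm x y f))
      exact ⟨r, hr.symm⟩)
  refine ⟨b, fun f => ?_⟩
  have h1 : y * b f = a ⟨y • (f : F), hmem y hym f⟩ := (hb f).trans (hb0 f)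
  have h2 : a ⟨y • (f : F), hmem y hym f⟩ = y * a f := by
    rw [← smul_eq_mul, ← map_smul]; rfl
  rw [h2, ← sub_eq_zero, ← mul_sub] at h1
  exact sub_eq_zero.1 (hy _ h1)

/-- embedding `M` in a cokernel of a map of free modules -/
lemma RC.wlem (h : RC R X) {n : ℕ} {i : (Fin n → R) →ₗ[R] E} {g : E →ₗ[R] M} (hs : SE i g)
    (hE : X E) (hM : X M) (hTL : TL R E) :
    ∃ (n' : ℕ) (e : E →ₗ[R] (Fin n' → R)), Function.Injective e ∧ DualSurj e ∧
      X ((Fin n' → R) ⧸ LinearMap.range (e ∘ₗ i)) ∧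
      ∃ j : M →ₗ[R] ((Fin n' → R) ⧸ LinearMap.range (e ∘ₗ i)), Function.Injective j := by
  have := h.fin E hE
  obtain ⟨n', e, he⟩ := exists_approx (R := R) (M := E)
  have hinj := he.inj hTL
  obtain ⟨j, hj⟩ := desc g hs.surj ((LinearMap.range (e ∘ₗ i)).mkQ ∘ₗ e) (by
    intro b hb
    obtain ⟨q, rfl⟩ := hs.ex b hb
    simp)
  have hji : Function.Injective j := by
    rw [← LinearMap.ker_eq_bot, LinearMap.ker_eq_bot']
    intro m hm
    obtain ⟨b, rfl⟩ := hs.surj m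
    rw [hj] at hm
    have : e b ∈ LinearMap.range (e ∘ₗ i) := by simpa using hm
    obtain ⟨q, hq⟩ := this
    rw [← hinj hq, hs.zero]
  refine ⟨n', e, hinj, he, ?_, j, hji⟩
  refine h.ext (i := j) (g := (LinearMap.range (e ∘ₗ i)).liftQ (LinearMap.range e).mkQ ?_)
    ⟨hji, ?_, ?_, ?_⟩ hM (h.cosyz e he hE)
  · rintro _ ⟨q, rfl⟩
    simp
  · intro w
    obtain ⟨v, rfl⟩ := Submodule.mkQ_surjective _ w
    exact ⟨Submodule.Quotient.mk v, rfl⟩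
  · intro m
    obtain ⟨b, rfl⟩ := hs.surj m
    rw [hj]; simp
  · intro w
    obtain ⟨v, rfl⟩ := Submodule.mkQ_surjective _ w
    intro hw
    have : v ∈ LinearMap.range e := by simpa using hw
    obtain ⟨b, rfl⟩ := this
    exact ⟨g b, hj b⟩

/-- multiplication map `T^n → T` -/
def sx {n : ℕ} (x : Fin n → R) (T : Type) [AddCommGroup T] [Module R T] :
    (Fin n → T) →ₗ[R] T := ∑ i, x i • LinearMap.proj i

lemma range_sx {n : ℕ} {x : Fin n → R} (hx : Submodule.span R (Set.range x) = maximalIdeal R) :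
    LinearMap.range (sx x M) = (maximalIdeal R • ⊤ : Submodule R M) := by
  apply le_antisymm
  · rintro _ ⟨v, rfl⟩
    simp only [sx, LinearMap.sum_apply, LinearMap.smul_apply, LinearMap.proj_apply]
    exact Submodule.sum_mem _ (fun i _ => Submodule.smul_mem_smul (gens_mem hx i) trivial)
  · rw [Submodule.smul_le]
    intro r hr t _
    rw [← hx] at hr
    have : Submodule.span R (Set.range x) ≤
        (LinearMap.range (sx x M)).comap (LinearMap.toSpanSingleton R M t) := by
      rw [Submodule.span_le]
      rintro _ ⟨i, rfl⟩
      refine ⟨Pi.single i t, ?_⟩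
      simp only [sx, LinearMap.sum_apply, LinearMap.smul_apply, LinearMap.proj_apply]
      rw [Finset.sum_eq_single i]
      · simp
      · intro j _ hj
        simp [hj]
      · simp
    exact this hr

lemma RC.yreg (hym : y ∈ maximalIdeal R) (hy : ∀ r : R, y * r = 0 → r = 0)
    (h : RC R X) (hk : ¬ X (ResidueField R)) (hM : X M) (t : M) (ht : y • t = 0) :
    t = 0 := by
  by_contra ht0
  apply hk
  obtain ⟨n, x, hx⟩ := exists_gens R
  let T := LinearMap.ker (y • LinearMap.id : M →ₗ[R] M)
  have hyT : ∀ t : T, y • t = 0 := fun t => Subtype.ext t.2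
  have hT : X T := h.coneKer hy _ hM hM (fun a ha => ha)
  have := h.fin _ hT
  let t' : T := ⟨t, ht⟩
  have ht' : t' ≠ 0 := fun h0 => ht0 (congrArg Subtype.val h0)
  by_cases hns : ∀ z, (∀ x ∈ maximalIdeal R, ∃ r, x * z = y * r) → ∃ r, z = y * r
  · have hY := h.coneQuot hy (sx x T) (h.pi hT n) hT (fun a _ => funext fun i => hyT (a i))
    have hkill : ∀ x' ∈ maximalIdeal R, ∀ v : T ⧸ LinearMap.range (sx x T), x' • v = 0 := by
      intro x' hx' v
      obtain ⟨t, rfl⟩ := Submodule.mkQ_surjective _ v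
      rw [← map_smul, Submodule.mkQ_apply, Submodule.Quotient.mk_eq_zero, range_sx hx]
      exact Submodule.smul_mem_smul hx' trivial
    have hV := h.of_yc hY (E1_noSocle hy hns hym hkill)
    obtain ⟨t1, ht1⟩ := nakayama (R := R) ht'
    refine h.of_killed hV hkill (t := Submodule.Quotient.mk t1) ?_
    rw [Ne, Submodule.Quotient.mk_eq_zero, range_sx hx]
    exact ht1
  · push Not at hns
    obtain ⟨z, hz, hz0⟩ := hns
    obtain ⟨k, E, _, _, i, g, hs, hE, hE1⟩ := h.univ (h.yc hT)
    by_cases hE0 : ∀ e : E, y • e = 0 → e = 0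
    · have hTL : TL R E := by
        intro e he
        apply hE0
        obtain ⟨l, hl⟩ := lift_inj i hs.inj (y • LinearMap.id) (fun e => hs.ex _ (by
          change g (y • e) = 0
          rw [map_smul, hyT]))
        have : l e = 0 := TL_pi _ (fun a => he (a ∘ₗ l))
        have h2 := hl e
        rw [this, map_zero] at h2
        exact h2.symm
      obtain ⟨n', e, hinj, -, hW, j, hj⟩ := h.wlem hs hE hT hTL
      have hreg : ∀ {m : ℕ} (v : Fin m → R), y • v = 0 → v = 0 := fun v hv =>
        funext fun i => hy _ (congrFun hv i)
      have hreg2 : ∀ {m : ℕ} (v w : Fin m → R), y • v = y • w → v = w := fun v w hv => by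
        rw [← sub_eq_zero, ← smul_sub] at hv
        exact sub_eq_zero.1 (hreg _ hv)
      have hhinj : Function.Injective (e ∘ₗ i) := hinj.comp hs.inj
      rcases lemmaS (e ∘ₗ i) with ⟨r, hr⟩ | ⟨q, hq, i0, hi0⟩
      · exfalso
        apply ht'
        apply hj
        rw [map_zero]
        have h1 : y • j t' = 0 := by rw [← map_smul, hyT, map_zero]
        obtain ⟨w, hw⟩ := Submodule.mkQ_surjective _ (j t')
        rw [← hw, ← map_smul, Submodule.mkQ_apply, Submodule.Quotient.mk_eq_zero] at h1
        obtain ⟨q, hq⟩ := h1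
        have h2 : q = y • r w := by rw [← hr q, hq, map_smul]
        rw [h2, map_smul] at hq
        rw [← hw, Submodule.mkQ_apply, Submodule.Quotient.mk_eq_zero]
        exact ⟨r w, hreg2 _ _ hq⟩
      · choose w hw using fun j => hz _ (hq j)
        have hw' : z • (e ∘ₗ i) q = y • w := funext fun j => by
          simp only [Pi.smul_apply, smul_eq_mul]
          rw [mul_comm]; exact hw j
        refine h.socle hym hy hW (s := Submodule.Quotient.mk w) ?_ ?_
        · rw [Ne, Submodule.Quotient.mk_eq_zero]
          rintro ⟨q', hq'⟩
          rw [← hq', ← map_smul, ← map_smul] at hw'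
          have h3 := congrFun (hhinj hw') i0
          simp only [Pi.smul_apply, smul_eq_mul] at h3
          rw [mem_maximalIdeal, mem_nonunits_iff, not_not] at hi0
          obtain ⟨u, hu⟩ := hi0.exists_right_inv
          refine hz0 (q' i0 * u) ?_
          rw [← mul_assoc, ← h3, mul_assoc, hu, mul_one]
        · intro x' hx'
          obtain ⟨r, hr⟩ := hz x' hx'
          rw [← Submodule.Quotient.mk_smul, Submodule.Quotient.mk_eq_zero]
          refine ⟨r • q, hreg2 _ _ ?_⟩
          rw [map_smul, smul_comm y x', ← hw', ← mul_smul, ← mul_smul, hr]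
    · push Not at hE0
      obtain ⟨e0, he0, he00⟩ := hE0
      let T' := LinearMap.ker (y • LinearMap.id : E →ₗ[R] E)
      have hyT' : ∀ t : T', y • t = 0 := fun t => Subtype.ext t.2
      have hT' : X T' := h.coneKer hy _ hE hE (fun a ha => ha)
      have := h.fin _ hT'
      let φ : (Fin n → T') →ₗ[R] E := T'.subtype ∘ₗ sx x T'
      have hY := h.coneQuot hy φ (h.pi hT' n) hE (fun a _ => funext fun i => hyT' (a i))
      have hV := h.of_yc hY (E1_quot (SE.ofSub (LinearMap.range φ)) hE1 (by
        intro a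
        refine ⟨0, ?_⟩
        rintro ⟨_, v, rfl⟩
        symm
        apply hy
        rw [← smul_eq_mul, ← map_smul]
        convert map_zero a
        apply Subtype.ext
        change y • φ v = 0
        rw [← map_smul]
        have : y • v = 0 := funext fun i => hyT' (v i)
        rw [this, map_zero]))
      obtain ⟨t1, ht1⟩ := nakayama (R := R) (D := T') (d := ⟨e0, he0⟩)
        (fun h0 => he00 (congrArg Subtype.val h0))
      refine h.socle hym hy hV (s := Submodule.Quotient.mk (t1 : E)) ?_ ?_
      · rw [Ne, Submodule.Quotient.mk_eq_zero]
        rintro ⟨v, hv⟩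
        apply ht1
        rw [← range_sx hx]
        exact ⟨v, Subtype.ext hv⟩
      · intro x' hx'
        rw [← Submodule.Quotient.mk_smul, Submodule.Quotient.mk_eq_zero]
        have : x' • t1 ∈ (maximalIdeal R • ⊤ : Submodule R T') :=
          Submodule.smul_mem_smul hx' trivial
        rw [← range_sx hx] at this
        obtain ⟨v, hv⟩ := this
        exact ⟨v, congrArg Subtype.val hv⟩

lemma RC.powreg (hym : y ∈ maximalIdeal R) (hy : ∀ r : R, y * r = 0 → r = 0)
    (h : RC R X) (hk : ¬ X (ResidueField R)) (hM : X M) (n : ℕ) :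
    ∀ t : M, y ^ n • t = 0 → t = 0 := by
  induction n with
  | zero => intro t ht; simpa using ht
  | succ n ih =>
    intro t ht
    rw [pow_succ, mul_smul] at ht
    exact h.yreg hym hy hk hM t (ih _ ht)

lemma tauY (hym : y ∈ maximalIdeal R) (hy : ∀ r : R, y * r = 0 → r = 0)
    (h : RC R X) (hk : ¬ X (ResidueField R)) (hN : X N) (hE1 : E1 R N) : TL R N := by
  intro s hst
  have hfin := h.fin N hN
  have key : ∀ n : ℕ, s ∈ LinearMap.range (y ^ n • LinearMap.id : N →ₗ[R] N) := by
    intro n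
    have hreg := fun (M : Type) [AddCommGroup M] [Module R M] (hM : X M) =>
      h.powreg hym hy hk hM n
    generalize y ^ n = c at hreg ⊢
    set C := LinearMap.range (c • LinearMap.id : N →ₗ[R] N) with hC
    have hY := h.coneQuot hy (c • LinearMap.id : N →ₗ[R] N) hN hN (fun a ha => by
      rw [hreg N hN a ha, smul_zero])
    obtain ⟨k, E, _, _, i, g, hs, hE, _⟩ := h.univ hY
    obtain ⟨m, p, hp⟩ := Module.Finite.exists_fin' R N
    obtain ⟨l, hl⟩ := Module.projective_lifting_property g (C.mkQ ∘ₗ p) hs.surj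
    have hl' : ∀ f, g (l f) = C.mkQ (p f) := fun f => LinearMap.congr_fun hl f
    obtain ⟨μ, hμ⟩ := lift_inj i hs.inj (c • l) (fun f => hs.ex _ (by
      change g (c • l f) = 0
      rw [map_smul, hl', ← map_smul, Submodule.mkQ_apply, Submodule.Quotient.mk_eq_zero]
      exact ⟨p f, rfl⟩))
    obtain ⟨α, hα⟩ := lift_inj i hs.inj (l ∘ₗ (LinearMap.ker p).subtype) (fun f => hs.ex _ (by
      change g (l f) = 0
      rw [hl', LinearMap.mem_ker.1 f.2, map_zero]))
    obtain ⟨b, hb⟩ := DualSurj.pi (hE1 _ p hp) α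
    obtain ⟨θ, hθ⟩ := desc p hp (μ - c • b) (by
      intro u hu
      apply hs.inj
      have h1 := hb ⟨u, hu⟩
      have h2 := hα ⟨u, hu⟩
      simp only [LinearMap.sub_apply, LinearMap.smul_apply, map_sub, map_smul, hμ,
        Submodule.subtype_apply, LinearMap.comp_apply] at h1 h2 ⊢
      rw [h1, h2, sub_self, map_zero])
    obtain ⟨f, rfl⟩ := hp s
    have h0 : θ (p f) = 0 := TL_pi _ (fun a => hst (a ∘ₗ θ))
    rw [hθ, LinearMap.sub_apply, sub_eq_zero, LinearMap.smul_apply] at h0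
    have h1 := hμ f
    rw [h0, map_smul, LinearMap.smul_apply, ← sub_eq_zero, ← smul_sub] at h1
    have h2 := sub_eq_zero.1 (hreg E hE _ h1)
    have h3 := hl' f
    rw [← h2, hs.zero] at h3
    exact (Submodule.Quotient.mk_eq_zero _).1 h3.symm
  have hkrull := Ideal.iInf_pow_smul_eq_bot_of_isLocalRing (M := N) (maximalIdeal R)
    (Ideal.IsPrime.ne_top inferInstance)
  have : s ∈ (⨅ i : ℕ, maximalIdeal R ^ i • (⊤ : Submodule R N)) := by
    rw [Submodule.mem_iInf]
    intro n
    obtain ⟨v, hv⟩ := key n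
    rw [← hv]
    exact Submodule.smul_mem_smul (Ideal.pow_mem_pow hym n) trivial
  rw [hkrull] at this
  simpa using this

end pos
end S16

namespace S16

set_option linter.unusedSectionVars false
section main
open IsLocalRing
variable {R : Type} [CommRing R]
variable {G M N D D' V E : Type} [AddCommGroup M] [Module R M] [AddCommGroup N] [Module R N]
  [AddCommGroup D] [Module R D] [AddCommGroup D'] [Module R D'] [AddCommGroup V] [Module R V]
  [AddCommGroup E] [Module R E] [AddCommGroup G] [Module R G]

/-- injectivity modulo an ideal -/
def InjMod (I : Ideal R) (g : D →ₗ[R] G) : Prop :=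
  ∀ d, g d ∈ (I • ⊤ : Submodule R G) → d ∈ (I • ⊤ : Submodule R D)

lemma mem_smul_map (I : Ideal R) (f : D →ₗ[R] G) {d : D} (hd : d ∈ (I • ⊤ : Submodule R D)) :
    f d ∈ (I • ⊤ : Submodule R G) := by
  have h : f d ∈ (I • ⊤ : Submodule R D).map f := ⟨d, hd, rfl⟩
  rw [Submodule.map_smul''] at h
  exact Submodule.smul_mono le_rfl le_top h

lemma mem_smul_surj (I : Ideal R) (f : D →ₗ[R] G) (hf : Function.Surjective f) {v : G}
    (hv : v ∈ (I • ⊤ : Submodule R G)) : ∃ d ∈ (I • ⊤ : Submodule R D), f d = v := by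
  have h : (I • ⊤ : Submodule R D).map f = I • ⊤ := by
    rw [Submodule.map_smul'', Submodule.map_top, LinearMap.range_eq_top.2 hf]
  rw [← h] at hv
  exact hv

lemma mem_pi (I : Ideal R) {n : ℕ} (v : Fin n → R) :
    v ∈ (I • ⊤ : Submodule R (Fin n → R)) ↔ ∀ i, v i ∈ I := by
  constructor
  · intro h i
    have := mem_smul_map I (LinearMap.proj i : (Fin n → R) →ₗ[R] R) h
    simpa using this
  · intro h
    rw [← Finset.univ_sum_single v]
    refine Submodule.sum_mem _ (fun i _ => ?_)
    have : (Pi.single i (v i) : Fin n → R) = v i • Pi.single i 1 := by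
      rw [← Pi.single_smul]; simp
    rw [this]
    exact Submodule.smul_mem_smul (h i) trivial

lemma step (I : Ideal R) {b : ℕ} (g : D →ₗ[R] G) (c : G →ₗ[R] D') (hc : Function.Surjective c)
    (hgc : ∀ d, c (g d) = 0) (hex : ∀ v, c v = 0 → ∃ d, g d = v)
    (g' : D' →ₗ[R] (Fin b → R)) (h1 : InjMod I g) (h2 : InjMod I g') (x : R)
    (hx : ∀ r, x * r ∈ I → r ∈ I) : InjMod (I ⊔ Ideal.span {x}) g := by
  intro d hd
  rw [Submodule.sup_smul, Submodule.mem_sup] at hd ⊢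
  obtain ⟨u, hu, w, hw, huw⟩ := hd
  rw [Submodule.ideal_span_singleton_smul] at hw
  obtain ⟨v, -, rfl⟩ := hw
  have e1 : c u + x • c v = 0 := by
    rw [← hgc d, ← huw, map_add]; simp
  have e2 : c v ∈ (I • ⊤ : Submodule R D') := by
    apply h2
    rw [mem_pi]
    intro j
    apply hx
    have e3 : x • g' (c v) ∈ (I • ⊤ : Submodule R (Fin b → R)) := by
      rw [← map_smul, eq_neg_of_add_eq_zero_right e1, map_neg]
      exact Submodule.neg_mem _ (mem_smul_map I g' (mem_smul_map I c hu))
    exact (mem_pi I _).1 e3 j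
  obtain ⟨u', hu', hcu⟩ := mem_smul_surj I c hc e2
  obtain ⟨d1, hd1⟩ := hex (v - u') (by rw [map_sub, hcu, sub_self])
  have e4 : d - x • d1 ∈ (I • ⊤ : Submodule R D) := by
    apply h1
    rw [map_sub, map_smul, hd1, ← huw]
    have e5 : u + x • v - x • (v - u') ∈ (I • ⊤ : Submodule R G) := by
      have : u + x • v - x • (v - u') = u + x • u' := by
        rw [smul_sub]; abel
      rw [this]
      exact Submodule.add_mem _ hu (Submodule.smul_mem _ _ hu')
    exact e5
  refine ⟨d - x • d1, e4, x • d1, ?_, by abel⟩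
  exact Submodule.smul_mem_smul (Ideal.mem_span_singleton_self x) trivial

variable [IsNoetherianRing R] [IsLocalRing R]
  {X : ∀ (M : Type) [AddCommGroup M] [Module R M], Prop}

lemma splitY {y : R} (hym : y ∈ maximalIdeal R) (hy : ∀ r : R, y * r = 0 → r = 0)
    (h : RC R X) (hk : ¬ X (ResidueField R)) {a b : ℕ} (H : (Fin a → R) →ₗ[R] (Fin b → R))
    (hH : Function.Injective H) (hW : X ((Fin b → R) ⧸ LinearMap.range H)) :
    ∃ r : (Fin b → R) →ₗ[R] (Fin a → R), ∀ q, r (H q) = q := by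
  rcases lemmaS H with hr | ⟨q, hq, i0, hi0⟩
  · exact hr
  exfalso
  let π := (LinearMap.range H).mkQ
  have hπ : Function.Surjective π := Submodule.mkQ_surjective _
  have hπH : ∀ q, π (H q) = 0 := fun q => by simp [π]
  have hπe : ∀ v, π v = 0 → ∃ q, H q = v := fun v hv => by simpa [π] using hv
  let L := LinearMap.ker (cc π (y • LinearMap.id))
  have hL : X L := h.cone π hπ _ hW hW
  have hLTL : TL R L := by
    intro l hl
    have h1 : l.1.1 = 0 := TL_pi _ (fun b => hl (b ∘ₗ LinearMap.fst R _ _ ∘ₗ L.subtype))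
    have h2 := l.2
    rw [LinearMap.mem_ker, cc_apply, h1, map_zero, zero_sub, neg_eq_zero] at h2
    exact Subtype.ext (Prod.ext h1 (h.yreg hym hy hk hW _ h2))
  have := h.fin _ hL
  obtain ⟨m, γ, hγ⟩ := exists_approx (R := R) (M := L)
  have hE0 := h.cosyz γ hγ hL
  have hE01 := E1_cosyz γ hγ
  let α : (Fin a → R) →ₗ[R] (Fin a → R) × (Fin b → R) := (-(y • LinearMap.id)).prod H
  let β : ((Fin a → R) × (Fin b → R)) →ₗ[R] L :=
    ((H ∘ₗ LinearMap.fst R _ _ + y • LinearMap.snd R _ _).prod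
      (π ∘ₗ LinearMap.snd R _ _)).codRestrict _ (by
        intro v
        change π (H v.1 + y • v.2) - y • π v.2 = 0
        rw [map_add, hπH, map_smul, zero_add, sub_self])
  have hβα : ∀ q, β (α q) = 0 := by
    intro q
    apply Subtype.ext
    refine Prod.ext ?_ ?_
    · change H (-(y • q)) + y • H q = 0
      simp
    · exact hπH q
  have hβe : ∀ v, β v = 0 → ∃ q, α q = v := by
    rintro ⟨u, v⟩ huv
    have h1 : H u + y • v = 0 := congrArg (fun l : L => l.1.1) huv
    have h2 : π v = 0 := congrArg (fun l : L => l.1.2) huv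
    obtain ⟨q, rfl⟩ := hπe v h2
    refine ⟨q, Prod.ext ?_ rfl⟩
    change -(y • q) = u
    rw [← map_smul, ← map_add, ← map_zero H] at h1
    exact (eq_neg_of_add_eq_zero_left (hH h1)).symm
  have hβs : Function.Surjective β := by
    rintro ⟨⟨f, w⟩, hl⟩
    obtain ⟨v, rfl⟩ := hπ w
    have h1 : π (f - y • v) = 0 := by
      rw [map_sub, map_smul]; exact hl
    obtain ⟨u, hu⟩ := hπe _ h1
    refine ⟨(u, v), Subtype.ext (Prod.ext ?_ rfl)⟩
    change H u + y • v = f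
    rw [hu]; abel
  let good : Ideal R → Prop := fun I =>
    (∀ (D : Type) [AddCommGroup D] [Module R D], X D → E1 R D →
      ∀ (n : ℕ) (g : D →ₗ[R] (Fin n → R)), DualSurj g → InjMod I g) ∧ InjMod I γ ∧ InjMod I α
  have hbot : ∀ {D G : Type} [AddCommGroup D] [Module R D] [AddCommGroup G] [Module R G]
      (g : D →ₗ[R] G), Function.Injective g → InjMod (⊥ : Ideal R) g := by
    intro D G _ _ _ _ g hg d hd
    rw [Submodule.bot_smul, Submodule.mem_bot] at hd ⊢
    exact hg (hd.trans (map_zero g).symm)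
  have hgood0 : good ⊥ := by
    refine ⟨?_, hbot _ (hγ.inj hLTL), hbot _ ?_⟩
    · intro D _ _ hD hD1 n g hg
      exact hbot _ (hg.inj (tauY hym hy h hk hD hD1))
    · intro u v huv
      exact hH (congrArg Prod.snd huv)
  obtain ⟨I, ⟨hI, hgood⟩, hmax⟩ := (inferInstance : WellFoundedGT (Ideal R)).wf.has_min
    {I | I ≠ ⊤ ∧ good I} ⟨⊥, bot_ne_top, hgood0⟩
  rcases dichotomy I with ⟨z, hz, hzm⟩ | ⟨x, hxm, hx⟩
  · have h1 : z • α q ∈ (I • ⊤ : Submodule R ((Fin a → R) × (Fin b → R))) := by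
      have e : z • α q = LinearMap.inl R _ _ (z • -(y • q)) + LinearMap.inr R _ _ (z • H q) := by
        refine Prod.ext ?_ ?_
        · simp [α]
        · simp [α]
      rw [e]
      refine Submodule.add_mem _ (mem_smul_map I _ ?_) (mem_smul_map I _ ?_)
      · rw [mem_pi]; intro i
        have := I.mul_mem_right (-(q i)) (hzm y hym)
        convert this using 1
        simp; ring
      · rw [mem_pi]; intro i
        rw [Pi.smul_apply, smul_eq_mul, mul_comm]
        exact hzm _ (hq i)
    rw [← map_smul] at h1
    have h2 := (mem_pi I _).1 (hgood.2.2 _ h1) i0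
    rw [mem_maximalIdeal, mem_nonunits_iff, not_not] at hi0
    rw [Pi.smul_apply, smul_eq_mul] at h2
    exact hz ((Ideal.mul_unit_mem_iff_mem I hi0).1 h2)
  · refine hmax (I ⊔ Ideal.span {x}) ⟨?_, ?_⟩ ?_
    · have : I ⊔ Ideal.span {x} ≤ maximalIdeal R :=
        sup_le (le_maximalIdeal hI) ((Ideal.span_singleton_le_iff_mem _).2 hxm)
      exact fun h0 => (Ideal.IsPrime.ne_top (inferInstance : (maximalIdeal R).IsPrime))
        (top_le_iff.1 (h0 ▸ this))
    · refine ⟨?_, ?_, ?_⟩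
      · intro D _ _ hD hD1 n g hg
        have hD' := h.cosyz g hg hD
        have hD1' := E1_cosyz g hg
        have := h.fin _ hD'
        obtain ⟨k, g', hg'⟩ := exists_approx (R := R) (M := (Fin n → R) ⧸ LinearMap.range g)
        exact step I g (LinearMap.range g).mkQ (Submodule.mkQ_surjective _)
          (fun d => by simp) (fun v hv => by simpa using hv) g'
          (hgood.1 D hD hD1 n g hg) (hgood.1 _ hD' hD1' k g' hg') x hx
      · have := h.fin _ hE0
        obtain ⟨k, g', hg'⟩ := exists_approx (R := R) (M := (Fin m → R) ⧸ LinearMap.range γ)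
        exact step I γ (LinearMap.range γ).mkQ (Submodule.mkQ_surjective _)
          (fun d => by simp) (fun v hv => by simpa using hv) g'
          hgood.2.1 (hgood.1 _ hE0 hE01 k g' hg') x hx
      · exact step I α β hβs hβα hβe γ hgood.2.2 hgood.2.1 x hx
    · change I < _
      refine lt_of_le_of_ne le_sup_left (fun h0 => hI ?_)
      have hxI : x ∈ I := by
        rw [h0]; exact Ideal.mem_sup_right (Ideal.mem_span_singleton_self x)
      rw [Ideal.eq_top_iff_one]
      exact hx 1 (by simpa using hxI)

theorem RC.main (h : RC R X) (hk : ¬ X (ResidueField R)) (hM : X M) : TL R M ∧ E1 R M := by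
  obtain ⟨n, E, _, _, i, g, hs, hE, hE1⟩ := h.univ (h.yc hM)
  have key : ∃ (n' : ℕ) (e : E →ₗ[R] (Fin n' → R)) (r : (Fin n' → R) →ₗ[R] (Fin n → R)),
      Function.Injective e ∧ ∀ q, r (e (i q)) = q := by
    rcases dichotomy (⊥ : Ideal R) with ⟨z, hz0, hz⟩ | ⟨y, hym, hy⟩
    · obtain ⟨n', e, hinj, -, hW, -⟩ := h.wlem hs hE hM (tau0 h hk hz0 hz hE hE1)
      rcases lemmaS (e ∘ₗ i) with ⟨r, hr⟩ | ⟨q, hq, i0, hi0⟩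
      · exact ⟨n', e, r, hinj, hr⟩
      · exfalso
        have h0 : (e ∘ₗ i) (z • q) = 0 := by
          rw [map_smul]
          funext j
          have := hz _ (hq j)
          rw [mul_comm] at this
          exact this
        have h1 : z • q = 0 := by
          apply hs.inj; apply hinj; rw [map_zero, map_zero]; exact h0
        have h2 : z * q i0 = 0 := congrFun h1 i0
        rw [mem_maximalIdeal, mem_nonunits_iff, not_not] at hi0
        exact hz0 ((hi0.mul_left_eq_zero).1 h2)
    · obtain ⟨n', e, hinj, -, hW, -⟩ := h.wlem hs hE hM (tauY hym hy h hk hE hE1)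
      obtain ⟨r, hr⟩ := splitY hym hy h hk (e ∘ₗ i) (hinj.comp hs.inj) hW
      exact ⟨n', e, r, hinj, hr⟩
  obtain ⟨n', e, r, hinj, hr⟩ := key
  have hi : DualSurj i := fun a => ⟨a ∘ₗ r ∘ₗ e, fun q => by simp [hr]⟩
  refine ⟨?_, E1_quot hs hE1 hi⟩
  obtain ⟨_, s, _, h2, _⟩ := hs.retract hi
  exact TL_of_inj (e ∘ₗ s) (hinj.comp (fun a b hab => by rw [← h2 a, ← h2 b, hab])) TL_pi

end main
end S16

namespace S16

section stable
variable {R : Type} [CommRing R]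
variable {K K' A B M N P P' : Type} [AddCommGroup K] [Module R K] [AddCommGroup B] [Module R B]
    [AddCommGroup K'] [Module R K']
    [AddCommGroup M] [Module R M] [AddCommGroup N] [Module R N] [AddCommGroup P] [Module R P]
    [AddCommGroup P'] [Module R P'] [AddCommGroup A] [Module R A]

lemma E1_prodP [Module.Projective R P] (h : E1 R M) : E1 R (M × P) := by
  obtain ⟨F, _, _, p, _, hp⟩ := exists_cover R M
  have : Module.Projective R F := inferInstance
  refine E1_of_proj (P := F × P) (p.prodMap LinearMap.id)
    (hp.prodMap Function.surjective_id) ?_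
  intro a
  let s : LinearMap.ker p →ₗ[R] LinearMap.ker (p.prodMap (LinearMap.id : P →ₗ[R] P)) :=
    (LinearMap.inl R _ _ ∘ₗ (LinearMap.ker p).subtype).codRestrict _ (fun c => by simp)
  obtain ⟨b, hb⟩ := h _ p hp (a ∘ₗ s)
  refine ⟨b ∘ₗ LinearMap.fst R _ _, ?_⟩
  rintro ⟨⟨x, q⟩, hx⟩
  have hq : q = 0 := congrArg Prod.snd hx
  subst hq
  exact hb ⟨x, congrArg Prod.fst hx⟩

lemma E1_retract (i : N →ₗ[R] M) (r : M →ₗ[R] N) (h : ∀ n, r (i n) = n) (hM : E1 R M) :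
    E1 R N := by
  refine E1_quot (SE.ofSurj r (fun n => ⟨i n, h n⟩)) hM ?_
  intro a
  refine ⟨a ∘ₗ (LinearMap.id - i ∘ₗ r).codRestrict (LinearMap.ker r) (fun m => by simp [h]), ?_⟩
  rintro ⟨k, hk⟩
  rw [LinearMap.mem_ker] at hk
  simp only [LinearMap.comp_apply, Submodule.subtype_apply]
  congr 1
  ext
  simp [hk]

/-- one half of Schanuel: the pullback -/
lemma schanuel_half [Module.Projective R P'] {i : K →ₗ[R] P} {p : P →ₗ[R] M} (hs : SE i p)
    (p' : P' →ₗ[R] M) :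
    Nonempty ((K × P') ≃ₗ[R] LinearMap.ker (p.coprod (-p'))) := by
  obtain ⟨l, hl⟩ := Module.projective_lifting_property p p' hs.surj
  have hl' : ∀ x, p (l x) = p' x := fun x => by rw [← hl]; rfl
  let φ : (K × P') →ₗ[R] LinearMap.ker (p.coprod (-p')) :=
    LinearMap.codRestrict _ ((i.coprod l).prod (LinearMap.snd R K P'))
      (fun x => by simp [hl', hs.zero])
  refine ⟨LinearEquiv.ofBijective φ ⟨?_, ?_⟩⟩
  · rw [← LinearMap.ker_eq_bot, LinearMap.ker_eq_bot']
    rintro ⟨k, x⟩ hx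
    have h1 := congrArg Subtype.val hx
    have h2 : x = 0 := congrArg Prod.snd h1
    subst h2
    have h3 := congrArg Prod.fst h1
    simp [φ] at h3
    have : k = 0 := hs.inj (by rw [h3, map_zero])
    simp [this]
  · rintro ⟨⟨x, x'⟩, hx⟩
    simp only [LinearMap.mem_ker, LinearMap.coprod_apply, LinearMap.neg_apply,
      add_neg_eq_zero] at hx
    obtain ⟨k, hk⟩ := hs.ex (x - l x') (by rw [map_sub, hl', hx, sub_self])
    refine ⟨(k, x'), ?_⟩
    ext <;> simp [φ, hk]

lemma schanuel [Module.Projective R P] [Module.Projective R P'] {i : K →ₗ[R] P} {p : P →ₗ[R] M}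
    {i' : K' →ₗ[R] P'} {p' : P' →ₗ[R] M} (hs : SE i p) (hs' : SE i' p') :
    Nonempty ((K × P') ≃ₗ[R] (K' × P)) := by
  obtain ⟨e⟩ := schanuel_half hs p'
  obtain ⟨e'⟩ := schanuel_half hs' p
  have hm : ∀ x : P × P', x ∈ LinearMap.ker (p.coprod (-p')) ↔
      LinearEquiv.prodComm R P P' x ∈ LinearMap.ker (p'.coprod (-p)) := by
    rintro ⟨x, y⟩
    simp only [LinearMap.mem_ker, LinearMap.coprod_apply, LinearMap.neg_apply, add_neg_eq_zero,
      LinearEquiv.prodComm_apply, Prod.swap_prod_mk]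
    exact eq_comm
  refine ⟨e ≪≫ₗ (LinearEquiv.ofSubmodules (LinearEquiv.prodComm R P P') _ _ ?_) ≪≫ₗ e'.symm⟩
  ext ⟨y, x⟩
  rw [Submodule.mem_map]
  constructor
  · rintro ⟨z, hz, h⟩
    rw [← h]; exact (hm z).1 hz
  · intro h
    exact ⟨(x, y), (hm (x, y)).2 h, rfl⟩

/-- classes of modules with `Ext^1` vanishing, stable under some choice of syzygies -/
def CI (R : Type) [CommRing R] (Z : ∀ (M : Type) [AddCommGroup M] [Module R M], Prop) : Prop :=
  ∀ (D : Type) [AddCommGroup D] [Module R D], Z D → E1 R D ∧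
    ∃ (P K : Type) (_ : AddCommGroup P) (_ : Module R P) (_ : AddCommGroup K) (_ : Module R K)
      (i : K →ₗ[R] P) (p : P →ₗ[R] D), Module.Projective R P ∧ SE i p ∧ Z K

/-- stable closure -/
def Zs (R : Type) [CommRing R] (Z : ∀ (M : Type) [AddCommGroup M] [Module R M], Prop)
    (D : Type) [AddCommGroup D] [Module R D] : Prop :=
  ∃ (D0 A B : Type) (_ : AddCommGroup D0) (_ : Module R D0) (_ : AddCommGroup A) (_ : Module R A)
    (_ : AddCommGroup B) (_ : Module R B), Module.Projective R A ∧ Module.Projective R B ∧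
    Z D0 ∧ Nonempty ((D × A) ≃ₗ[R] (D0 × B))

variable {Z : ∀ (M : Type) [AddCommGroup M] [Module R M], Prop}

lemma Zs.of (h : Z M) : Zs R Z M :=
  ⟨M, Fin 0 → R, Fin 0 → R, inferInstance, inferInstance, inferInstance, inferInstance,
    inferInstance, inferInstance, inferInstance, inferInstance, h, ⟨LinearEquiv.refl _ _⟩⟩

lemma Zs.e1 (hZ : CI R Z) (h : Zs R Z M) : E1 R M := by
  obtain ⟨D0, A, B, _, _, _, _, _, _, hA, hB, hD, ⟨e⟩⟩ := h
  refine E1_retract (e.toLinearMap ∘ₗ LinearMap.inl R M A) (LinearMap.fst R M A ∘ₗ e.symm.toLinearMap)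
    (fun n => by simp) (E1_prodP (hZ _ hD).1)

lemma SE.prodP {i : K →ₗ[R] P} {p : P →ₗ[R] M} (hs : SE i p) :
    SE (LinearMap.inl R P A ∘ₗ i) (p.prodMap (LinearMap.id : A →ₗ[R] A)) where
  inj := LinearMap.inl_injective.comp hs.inj
  surj := hs.surj.prodMap Function.surjective_id
  zero k := by simp [hs.zero]
  ex := by
    rintro ⟨x, a⟩ hx
    obtain ⟨k, hk⟩ := hs.ex x (congrArg Prod.fst hx)
    have ha : a = 0 := congrArg Prod.snd hx
    exact ⟨k, by simp [hk, ha]⟩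

lemma SE.equiv {i : K →ₗ[R] P} {p : P →ₗ[R] M} (hs : SE i p) (e : M ≃ₗ[R] N) :
    SE i (e.toLinearMap ∘ₗ p) where
  inj := hs.inj
  surj := e.surjective.comp hs.surj
  zero k := by simp [hs.zero]
  ex b hb := hs.ex b (by simpa using hb)

lemma Zs.syz (hZ : CI R Z) (h : Zs R Z M) [Module.Projective R P] {i : K →ₗ[R] P} {p : P →ₗ[R] M}
    (hs : SE i p) : Zs R Z K := by
  obtain ⟨D0, A, B, _, _, _, _, _, _, hA, hB, hD, ⟨e⟩⟩ := h
  obtain ⟨P0, K0, _, _, _, _, i0, p0, hP0, hs0, hK0⟩ := (hZ _ hD).2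
  exact ⟨K0, P0 × B, P × A, inferInstance, inferInstance, inferInstance, inferInstance,
    inferInstance, inferInstance, inferInstance, inferInstance, hK0,
    schanuel ((hs.prodP (A := A)).equiv e) (hs0.prodP (A := B))⟩

end stable

section reflexive
open IsLocalRing
variable {R : Type} [CommRing R] [IsNoetherianRing R] [IsLocalRing R]
  {X : ∀ (M : Type) [AddCommGroup M] [Module R M], Prop}
  {M : Type} [AddCommGroup M] [Module R M]

lemma bidual_pi {n : ℕ} (f : M →ₗ[R] (Fin n → R)) (ψ : (M →ₗ[R] R) →ₗ[R] R)
    (b : (Fin n → R) →ₗ[R] R) : ψ (b ∘ₗ f) = b (fun i => ψ (LinearMap.proj i ∘ₗ f)) := by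
  have : b ∘ₗ f = ∑ i, b (Pi.single i 1) • (LinearMap.proj i ∘ₗ f) := by
    ext m
    simp only [LinearMap.comp_apply, desc_single b (f m), LinearMap.sum_apply,
      LinearMap.smul_apply, LinearMap.proj_apply, smul_eq_mul, mul_comm]
  rw [this, map_sum, desc_single b]
  simp [mul_comm]

lemma RC.reflexive (h : RC R X) (hk : ¬ X (ResidueField R)) (hM : X M)
    (ψ : (M →ₗ[R] R) →ₗ[R] R) : ∃ m : M, ∀ a, ψ a = a m := by
  have := h.fin M hM
  obtain ⟨n, f, hf⟩ := exists_approx (R := R) (M := M)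
  have hC := (h.main hk (h.cosyz f hf hM)).1
  have h0 := hC ((LinearMap.range f).mkQ (fun i => ψ (LinearMap.proj i ∘ₗ f))) (fun c => by
    have := bidual_pi f ψ (c ∘ₗ (LinearMap.range f).mkQ)
    rw [LinearMap.comp_apply] at this
    rw [← this]
    convert map_zero ψ
    ext m
    have hz : (LinearMap.range f).mkQ (f m) = 0 := by simp
    simp only [LinearMap.comp_apply, hz, map_zero, LinearMap.zero_apply])
  have h1 : (fun i => ψ (LinearMap.proj i ∘ₗ f)) ∈ LinearMap.range f := by simpa using h0
  obtain ⟨m, hm⟩ := h1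
  refine ⟨m, fun a => ?_⟩
  obtain ⟨b, hb⟩ := hf a
  have : a = b ∘ₗ f := LinearMap.ext fun m => (hb m).symm
  rw [this, bidual_pi, ← hm]; rfl

lemma RC.bij (h : RC R X) (hk : ¬ X (ResidueField R)) (hM : X M) :
    Function.Bijective (Module.Dual.eval R M) := by
  constructor
  · rw [← LinearMap.ker_eq_bot, LinearMap.ker_eq_bot']
    intro m hm
    exact (h.main hk hM).1 m (fun a => LinearMap.congr_fun hm a)
  · intro ψ
    obtain ⟨m, hm⟩ := h.reflexive hk hM ψ
    exact ⟨m, LinearMap.ext fun a => (hm a).symm⟩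

lemma RC.ci (h : RC R X) (hk : ¬ X (ResidueField R)) : CI R X := by
  intro D _ _ hD
  refine ⟨(h.main hk hD).2, ?_⟩
  have := h.fin D hD
  obtain ⟨n, p, hp⟩ := Module.Finite.exists_fin' R D
  exact ⟨Fin n → R, LinearMap.ker p, inferInstance, inferInstance, inferInstance, inferInstance,
    _, p, inferInstance, SE.ofSurj p hp, h.kerS p hp (h.free n) hD⟩

/-- duals of modules in `X` -/
def DX (X : ∀ (M : Type) [AddCommGroup M] [Module R M], Prop)
    (V : Type) [AddCommGroup V] [Module R V] : Prop :=
  ∃ (M : Type) (_ : AddCommGroup M) (_ : Module R M), X M ∧ Nonempty ((M →ₗ[R] R) ≃ₗ[R] V)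

lemma RC.dci (h : RC R X) (hk : ¬ X (ResidueField R)) : CI R (DX X) := by
  rintro V _ _ ⟨M, _, _, hM, ⟨e⟩⟩
  have := h.fin M hM
  obtain ⟨n, f, hf⟩ := exists_approx (R := R) (M := M)
  have hXC := h.cosyz f hf hM
  have hs : SE (R := R) (K := ((Fin n → R) ⧸ LinearMap.range f) →ₗ[R] R) (B := (Fin n → R) →ₗ[R] R)
      (M := M →ₗ[R] R)
      (LinearMap.lcomp R R (LinearMap.range f).mkQ) (LinearMap.lcomp R R f) := by
    refine ⟨?_, ?_, ?_, ?_⟩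
    · intro a b hab
      ext x
      exact LinearMap.congr_fun hab _
    · intro a
      obtain ⟨b, hb⟩ := hf a
      exact ⟨b, LinearMap.ext hb⟩
    · intro c
      ext m
      have hz : (LinearMap.range f).mkQ (f m) = 0 := by simp
      simp only [LinearMap.lcomp_apply, hz, map_zero, LinearMap.zero_apply]
    · intro b hb
      refine ⟨(LinearMap.range f).liftQ b ?_, ?_⟩
      · rintro _ ⟨m, rfl⟩
        exact LinearMap.congr_fun hb m
      · ext x; simp
  have hP : Module.Projective R ((Fin n → R) →ₗ[R] R) := inferInstance
  have hE : E1 R (M →ₗ[R] R) := by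
    have hds : DualSurj (R := R) (LinearMap.lcomp R R (LinearMap.range f).mkQ :
        (((Fin n → R) ⧸ LinearMap.range f) →ₗ[R] R) →ₗ[R] _) := by
      intro ψ
      obtain ⟨c, hc⟩ := h.reflexive hk hXC ψ
      obtain ⟨q, rfl⟩ := Submodule.mkQ_surjective _ c
      refine ⟨Module.Dual.eval R _ q, fun a => ?_⟩
      rw [hc a]; rfl
    exact E1_quot hs E1_projective hds
  refine ⟨E1_retract e.symm.toLinearMap e.toLinearMap (fun n => by simp) hE, ?_⟩
  exact ⟨_, _, inferInstance, inferInstance, inferInstance, inferInstance, _, _, hP, hs.equiv e,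
    ⟨_, _, _, hXC, ⟨LinearEquiv.refl _ _⟩⟩⟩

end reflexive
end S16

namespace S16

section extv
variable {R : Type} [CommRing R]
variable {Z : ∀ (M : Type) [AddCommGroup M] [Module R M], Prop}

lemma res_step (hZ : CI R Z) {M : ModuleCat.{0} R} (hM : Zs R Z M) (P : ProjectiveResolution M)
    (n : ℕ) : ∃ (D : Type) (_ : AddCommGroup D) (_ : Module R D) (p : P.complex.X n →ₗ[R] D),
      Function.Surjective p ∧ Zs R Z D ∧
      ∀ x, p x = 0 ↔ ∃ y, (P.complex.d (n+1) n).hom y = x := by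
  have hproj : ∀ n, Module.Projective R (P.complex.X n) := fun n =>
    (IsProjective.iff_projective (P.complex.X n)).2 (P.projective n)
  induction n with
  | zero =>
    refine ⟨M, inferInstance, inferInstance, (P.π.f 0).hom, ?_, hM, fun x => ⟨?_, ?_⟩⟩
    · exact (ModuleCat.epi_iff_surjective (P.π.f 0)).1 inferInstance
    · exact (ShortComplex.moduleCat_exact_iff _).1 P.exact₀ x
    · rintro ⟨y, rfl⟩
      have := P.complex_d_comp_π_f_zero
      exact LinearMap.congr_fun (congrArg ModuleCat.Hom.hom this) y
  | succ n ih =>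
    obtain ⟨D, _, _, p, hp, hD, hpx⟩ := ih
    have hk := hD.syz hZ (SE.ofSurj p hp)
    refine ⟨LinearMap.ker p, inferInstance, inferInstance,
      (P.complex.d (n+1) n).hom.codRestrict _ (fun y => (hpx _).2 ⟨y, rfl⟩), ?_, hk, ?_⟩
    · rintro ⟨x, hx⟩
      obtain ⟨y, hy⟩ := (hpx x).1 hx
      exact ⟨y, Subtype.ext hy⟩
    · intro x
      have h1 := (ShortComplex.moduleCat_exact_iff _).1 (P.exact_succ n) x
      constructor
      · intro hx
        exact h1 (congrArg Subtype.val hx)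
      · rintro ⟨y, rfl⟩
        have := P.complex.d_comp_d (n+2) (n+1) n
        exact Subtype.ext (LinearMap.congr_fun (congrArg ModuleCat.Hom.hom this) y)

lemma ext_vanish (hZ : CI R Z) {M : ModuleCat.{0} R} (hM : Zs R Z M) (n : ℕ) :
    Subsingleton (((Ext R (ModuleCat.{0} R) (n+1)).obj (Opposite.op M)).obj (ModuleCat.of R R)) := by
  apply ModuleCat.subsingleton_of_isZero
  let P := ProjectiveResolution.of M
  refine Limits.IsZero.of_iso ?_ (P.isoExt (n + 1) (ModuleCat.of R R))
  rw [← HomologicalComplex.exactAt_iff_isZero_homology,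
    HomologicalComplex.exactAt_iff' _ n (n+1) (n+2) (by simp) (by simp),
    ShortComplex.moduleCat_exact_iff]
  intro (a : P.complex.X (n+1) ⟶ ModuleCat.of R R) ha
  have ha' : P.complex.d (n+2) (n+1) ≫ a = 0 := ha
  obtain ⟨D, _, _, p, hp, hD, hpx⟩ := res_step hZ hM P n
  obtain ⟨D', _, _, p', hp', hD', hpx'⟩ := res_step hZ hM P (n+1)
  obtain ⟨θ, hθ⟩ := desc (R := R) ((P.complex.d (n+1) n).hom.codRestrict (LinearMap.ker p)
      (fun y => (hpx _).2 ⟨y, rfl⟩))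
    (by
      rintro ⟨x, hx⟩
      obtain ⟨y, hy⟩ := (hpx x).1 hx
      exact ⟨y, Subtype.ext hy⟩) a.hom (by
      intro b hb
      obtain ⟨y, rfl⟩ := (ShortComplex.moduleCat_exact_iff _).1 (P.exact_succ n) b
        (congrArg Subtype.val hb)
      exact LinearMap.congr_fun (congrArg ModuleCat.Hom.hom ha') y)
  obtain ⟨b, hb⟩ := hD.e1 hZ _ p hp θ
  refine ⟨(ModuleCat.ofHom b : P.complex.X n ⟶ ModuleCat.of R R), ?_⟩
  change P.complex.d (n+1) n ≫ ModuleCat.ofHom b = a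
  ext x
  have h1 := hθ x
  rw [← hb] at h1
  exact h1

end extv
end S16

/-- a resolving subcategory closed under cosyzygies either contains the
residue field or consists of totally reflexive modules. -/
theorem stmt16 (R : Type) [CommRing R] [IsNoetherianRing R] [IsLocalRing R]
    (X : ModuleCat.{0} R → Prop) (hX : Resolving R X)
    (hco : ∀ M, X M → ∀ N, IsCosyzygy R N M → X N) :
    X (ModuleCat.of R (IsLocalRing.ResidueField R)) ∨
      ∀ M, X M → TotallyReflexive R M := by
  have hrc : S16.RC R (fun M _ _ => X (ModuleCat.of R M)) := by
    refine ⟨?_, ?_, ?_, ?_, ?_, ?_⟩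
    · intro M _ _ hM
      exact hX.fg _ hM
    · intro n
      exact hX.proj _ ⟨inferInstanceAs (Module.Finite R (Fin n → R)),
        inferInstanceAs (Module.Projective R (Fin n → R))⟩
    · intro M N _ _ _ _ i r hir hM
      refine hX.summand (ModuleCat.of R M) (ModuleCat.of R N)
        (ModuleCat.of R (LinearMap.ker r)) hM ⟨?_⟩
      let φ : M →ₗ[R] N × LinearMap.ker r := r.prod
        ((LinearMap.id - i ∘ₗ r).codRestrict (LinearMap.ker r) (fun m => by simp [hir]))
      refine (LinearEquiv.ofBijective φ ⟨?_, ?_⟩ : M ≃ₗ[R] N × LinearMap.ker r)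
      · rw [← LinearMap.ker_eq_bot, LinearMap.ker_eq_bot']
        intro m hm
        have h1 : r m = 0 := congrArg Prod.fst hm
        have h2 : m - i (r m) = 0 := congrArg Subtype.val (congrArg Prod.snd hm)
        simpa [h1] using h2
      · rintro ⟨n, k, hk⟩
        rw [LinearMap.mem_ker] at hk
        refine ⟨i n + k, ?_⟩
        ext
        · simp [φ, hir, hk]
        · simp [φ, hir, hk]
    · intro K B M _ _ _ _ _ _ i g hs hK hM
      refine hX.extension (ModuleCat.of R K) (ModuleCat.of R B) (ModuleCat.of R M) i g
        ⟨hs.inj, hs.surj, ?_⟩ hK hM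
      ext b
      exact ⟨fun hb => hs.ex b hb, by rintro ⟨k, rfl⟩; exact hs.zero k⟩
    · intro K B M _ _ _ _ _ _ i g hs hB hM
      refine hX.ker_epi (ModuleCat.of R K) (ModuleCat.of R B) (ModuleCat.of R M) i g
        ⟨hs.inj, hs.surj, ?_⟩ hB hM
      ext b
      exact ⟨fun hb => hs.ex b hb, by rintro ⟨k, rfl⟩; exact hs.zero k⟩
    · intro M _ _ n f hf hM
      refine hco (ModuleCat.of R M) hM _ ⟨ModuleCat.of R (Fin n → R), f, ⟨⟨?_, ?_⟩, ?_⟩,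
        ⟨LinearEquiv.refl _ _⟩⟩
      · exact inferInstanceAs (Module.Finite R (Fin n → R))
      · exact inferInstanceAs (Module.Projective R (Fin n → R))
      · intro Q hQ g
        have := hQ.1
        have := hQ.2
        exact hf.proj g
  by_cases hk : X (ModuleCat.of R (IsLocalRing.ResidueField R))
  · exact Or.inl hk
  · refine Or.inr (fun M hM => ⟨hrc.bij (M := M) hk hM, fun i hi => ?_⟩)
    obtain ⟨n, rfl⟩ : ∃ n, i = n + 1 := ⟨i - 1, by omega⟩
    refine ⟨S16.ext_vanish (hrc.ci hk) (S16.Zs.of hM) n,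
      S16.ext_vanish (hrc.dci hk) (S16.Zs.of ?_) n⟩
    exact ⟨M, inferInstance, inferInstance, hM, ⟨LinearEquiv.refl _ _⟩⟩
end
end

section
/- Let R be a Cohen–Macaulay local ring of positive dimension. Then R is Gorenstein if and only if the category CM(R) of maximal Cohen–Macaulay modules is closed under cosyzygies. -/
open CategoryTheory

noncomputable section

open Paper

namespace Pf

open CategoryTheory CategoryTheory.Abelian Limits Paper

section LES

variable {R : Type} [CommRing R]

/-- vanishing of the `Ext` group, in terms of unbundled modules -/
def XV (R : Type) [CommRing R] (A B : Type) [AddCommGroup A] [Module R A] [AddCommGroup B]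
    [Module R B] (n : ℕ) : Prop :=
  Subsingleton (Abelian.Ext (ModuleCat.of R A) (ModuleCat.of R B) n)

variable {A B C Y : Type} [AddCommGroup A] [Module R A] [AddCommGroup B] [Module R B]
  [AddCommGroup C] [Module R C] [AddCommGroup Y] [Module R Y]

/-- the short complex of an exact pair of linear maps -/
abbrev sc (f : A →ₗ[R] B) (g : B →ₗ[R] C) (h : Function.Exact f g) :
    ShortComplex (ModuleCat.{0} R) :=
  ShortComplex.mk (ModuleCat.ofHom f) (ModuleCat.ofHom g)
    (by ext x; exact h.apply_apply_eq_zero x)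

lemma sc_exact {f : A →ₗ[R] B} {g : B →ₗ[R] C} (h : Function.Exact f g)
    (hf : Function.Injective f) (hg : Function.Surjective g) : (sc f g h).ShortExact :=
  ModuleCat.shortComplex_shortExact _ h hf hg

lemma xv_iff {n : ℕ} : XV R A B n ↔
    ∀ e : Abelian.Ext (ModuleCat.of R A) (ModuleCat.of R B) n, e = 0 :=
  ⟨fun h e => h.elim _ _, fun h => ⟨fun a b => (h a).trans (h b).symm⟩⟩

variable {f : A →ₗ[R] B} {g : B →ₗ[R] C}

lemma con1 (h : Function.Exact f g)
    (hf : Function.Injective f) (hg : Function.Surjective g) {n : ℕ} (h1 : XV R B Y n) (h2 : XV R C Y (n+1)) : XV R A Y n := by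
  rw [xv_iff] at *
  intro e
  obtain ⟨y, rfl⟩ := Ext.contravariant_sequence_exact₁ (sc_exact h hf hg) (ModuleCat.of R Y) e
    (add_comm 1 n) (h2 _)
  obtain rfl := h1 y
  exact Ext.comp_zero ..

lemma con2 (h : Function.Exact f g)
    (hf : Function.Injective f) (hg : Function.Surjective g) {n : ℕ} (h1 : XV R A Y n) (h2 : XV R C Y n) : XV R B Y n := by
  rw [xv_iff] at *
  intro e
  obtain ⟨y, rfl⟩ := Ext.contravariant_sequence_exact₂ (sc_exact h hf hg) (ModuleCat.of R Y) e
    (h1 _)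
  obtain rfl := h2 y
  exact Ext.comp_zero ..

lemma con3 (h : Function.Exact f g)
    (hf : Function.Injective f) (hg : Function.Surjective g) {n : ℕ} (h1 : XV R A Y n) (h2 : XV R B Y (n+1)) : XV R C Y (n+1) := by
  rw [xv_iff] at *
  intro e
  obtain ⟨y, rfl⟩ := Ext.contravariant_sequence_exact₃ (sc_exact h hf hg) (ModuleCat.of R Y) e
    (h2 _) (add_comm 1 n)
  obtain rfl := h1 y
  exact Ext.comp_zero ..

lemma cov1 (h : Function.Exact f g)
    (hf : Function.Injective f) (hg : Function.Surjective g) {n : ℕ} (h1 : XV R Y C n) (h2 : XV R Y B (n+1)) : XV R Y A (n+1) := by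
  rw [xv_iff] at *
  intro e
  obtain ⟨y, rfl⟩ := Ext.covariant_sequence_exact₁ (ModuleCat.of R Y) (sc_exact h hf hg) e
    (h2 _) rfl
  obtain rfl := h1 y
  exact Ext.zero_comp ..

lemma cov2 (h : Function.Exact f g)
    (hf : Function.Injective f) (hg : Function.Surjective g) {n : ℕ} (h1 : XV R Y A n) (h2 : XV R Y C n) : XV R Y B n := by
  rw [xv_iff] at *
  intro e
  obtain ⟨y, rfl⟩ := Ext.covariant_sequence_exact₂ (ModuleCat.of R Y) (sc_exact h hf hg) e
    (h2 _)
  obtain rfl := h1 y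
  exact Ext.zero_comp ..

lemma xv_zero_iff : XV R A B 0 ↔ ∀ f : A →ₗ[R] B, f = 0 := by
  rw [XV, Ext.addEquiv₀.subsingleton_congr, ModuleCat.homAddEquiv.subsingleton_congr]
  exact ⟨fun h e => h.elim _ _, fun h => ⟨fun a b => (h a).trans (h b).symm⟩⟩

lemma cov1_zero (hf : Function.Injective f) (h2 : XV R Y B 0) : XV R Y A 0 := by
  rw [xv_zero_iff] at *
  intro φ
  ext x
  apply hf
  simpa using LinearMap.congr_fun (h2 (f ∘ₗ φ)) x

lemma xv_proj [Module.Projective R A] (n : ℕ) : XV R A Y (n+1) := by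
  rw [xv_iff]
  have : Projective (ModuleCat.of R A) := (IsProjective.iff_projective A).mp inferInstance
  exact fun e => Ext.eq_zero_of_projective _

lemma xv_congr_left (e : A ≃ₗ[R] B) {n : ℕ} (h : XV R A Y n) : XV R B Y n := by
  rw [xv_iff] at *
  intro x
  have h0 := h ((Ext.mk₀ e.toModuleIso.hom).comp x (zero_add n))
  have := congrArg (fun y => (Ext.mk₀ e.toModuleIso.inv).comp y (zero_add n)) h0
  simp only [Ext.mk₀_comp_mk₀_assoc, Iso.inv_hom_id, Ext.mk₀_id_comp, Ext.comp_zero] at this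
  exact this

lemma xv_congr_right (e : A ≃ₗ[R] B) {n : ℕ} (h : XV R Y A n) : XV R Y B n := by
  rw [xv_iff] at *
  intro x
  have h0 := h (x.comp (Ext.mk₀ e.toModuleIso.inv) (add_zero n))
  have := congrArg (fun y => y.comp (Ext.mk₀ e.toModuleIso.hom) (add_zero n)) h0
  simp only [Ext.comp_assoc_of_third_deg_zero, Ext.mk₀_comp_mk₀, Iso.inv_hom_id, Ext.comp_mk₀_id, Ext.zero_comp] at this
  exact this

lemma xv_one_extend (h : Function.Exact f g)
    (hf : Function.Injective f) (hg : Function.Surjective g) (h1 : XV R C Y 1) (φ : A →ₗ[R] Y) : ∃ ψ : B →ₗ[R] Y, ψ ∘ₗ f = φ := by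
  rw [xv_iff] at h1
  obtain ⟨y, hy⟩ := Ext.contravariant_sequence_exact₁ (sc_exact h hf hg) (ModuleCat.of R Y)
    (Ext.mk₀ (ModuleCat.ofHom φ)) (add_comm 1 0) (h1 _)
  obtain ⟨ψ, rfl⟩ := Ext.addEquiv₀.symm.surjective y
  refine ⟨ψ.hom, ?_⟩
  have h3 : (sc f g h).f ≫ ψ = ModuleCat.ofHom φ := by
    apply Ext.addEquiv₀.symm.injective
    refine Eq.trans ?_ hy
    exact (Ext.mk₀_comp_mk₀ _ _).symm
  have := congrArg ModuleCat.Hom.hom h3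
  simpa using this

lemma xv_one_of_extend (h : Function.Exact f g)
    (hf : Function.Injective f) (hg : Function.Surjective g) [Module.Projective R B]
    (H : ∀ φ : A →ₗ[R] Y, ∃ ψ : B →ₗ[R] Y, ψ ∘ₗ f = φ) : XV R C Y 1 := by
  rw [xv_iff]
  intro e
  obtain ⟨y, hy⟩ := Ext.contravariant_sequence_exact₃ (sc_exact h hf hg) (ModuleCat.of R Y) e
    ((xv_iff.1 (xv_proj (R := R) (A := B) (Y := Y) 0)) _) (add_comm 1 0)
  obtain ⟨φ, rfl⟩ := Ext.addEquiv₀.symm.surjective y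
  obtain ⟨ψ, hψ⟩ := H φ.hom
  have h3 : φ = (sc f g h).f ≫ ModuleCat.ofHom ψ := by
    ext x
    exact (LinearMap.congr_fun hψ x).symm
  rw [← hy, h3]
  simp only [Ext.addEquiv₀_symm_apply]
  rw [← Ext.mk₀_comp_mk₀, ← Ext.comp_assoc_of_third_deg_zero,
    ShortComplex.ShortExact.extClass_comp, Ext.zero_comp]

end LES
end Pf


namespace Pf

open CategoryTheory CategoryTheory.Abelian Limits Paper

lemma extVanish_iff {R : Type} [CommRing R] (M N : ModuleCat.{0} R) (n : ℕ) :
    ExtVanish R M N (n+1) ↔ XV R M N (n+1) := by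
  let P := projectiveResolution M
  have key : (∀ x : P.complex.X (n+1) ⟶ N, P.complex.d (n+2) (n+1) ≫ x = 0 →
      ∃ y : P.complex.X n ⟶ N, P.complex.d (n+1) n ≫ y = x) ↔ XV R M N (n+1) := by
    rw [xv_iff]
    constructor
    · intro H e
      obtain ⟨f, hf, rfl⟩ := P.extMk_surjective e (n+2) rfl
      exact (P.extMk_eq_zero_iff f (n+2) rfl hf n rfl).2 (H f hf)
    · intro H x hx
      exact (P.extMk_eq_zero_iff x (n+2) rfl hx n rfl).1 (H _)
  rw [← key, ExtVanish, ← ModuleCat.isZero_iff_subsingleton,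
    (P.isoExt (R := R) (n+1) N).isZero_iff, ← HomologicalComplex.exactAt_iff_isZero_homology,
    HomologicalComplex.exactAt_iff' _ n (n+1) (n+2) (by simp) (by simp),
    ShortComplex.moduleCat_exact_iff]
  rfl

section

variable {R : Type} [CommRing R] [IsLocalRing R]  [IsNoetherianRing R]
variable {A B C Y : Type} [AddCommGroup A] [Module R A] [AddCommGroup B] [Module R B]
  [AddCommGroup C] [Module R C] [AddCommGroup Y] [Module R Y]

lemma nak [Module.Finite R A] [Module.Finite R Y] {x : R} (hx : x ∈ IsLocalRing.maximalIdeal R)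
    (hreg : IsSMulRegular A x) {n : ℕ} (h : XV R (QuotSMulTop x A) Y (n+1)) : XV R A Y n := by
  have hreg' : IsSMulRegular (ModuleCat.of R A) x := hreg
  have hS := hreg'.smulShortComplex_shortExact
  have key : ∀ e : Abelian.Ext (ModuleCat.of R A) (ModuleCat.of R Y) n,
      ∃ e', x • e' = e := by
    intro e
    obtain ⟨y, hy⟩ := Ext.contravariant_sequence_exact₁ hS (ModuleCat.of R Y) e
      (add_comm 1 n) (xv_iff.1 h _)
    have smul_eq : ∀ z : Abelian.Ext (ModuleCat.of R A) (ModuleCat.of R Y) n,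
        x • z = (Ext.mk₀ (x • 𝟙 (ModuleCat.of R A))).comp z (zero_add n) := by
      intro z
      simp [Ext.mk₀_smul]
    exact ⟨y, (smul_eq y).trans hy⟩
  have hbot : (⊤ : Submodule R (Abelian.Ext (ModuleCat.of R A) (ModuleCat.of R Y) n)) = ⊥ := by
    apply Submodule.eq_bot_of_le_smul_of_le_jacobson_bot (IsLocalRing.maximalIdeal R) _
      (Module.finite_def.1 inferInstance)
    · intro e _
      obtain ⟨e', rfl⟩ := key e
      exact Submodule.smul_mem_smul hx trivial
    · rw [IsLocalRing.jacobson_eq_maximalIdeal]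
      exact bot_ne_top
  rw [xv_iff]
  intro e
  have : e ∈ (⊤ : Submodule R (Abelian.Ext (ModuleCat.of R A) (ModuleCat.of R Y) n)) := trivial
  rwa [hbot] at this

lemma subsing_weak [Subsingleton A] (rs : List R) : RingTheory.Sequence.IsWeaklyRegular A rs := by
  constructor
  intro i hi a b _
  exact Subsingleton.elim (h := by
    infer_instance) _ _

/-- the residue field as a quotient module -/
abbrev kk (R : Type) [CommRing R] [IsLocalRing R] : Type := R ⧸ IsLocalRing.maximalIdeal R

lemma depth_iff [Module.Finite R A] (n : ℕ) :
    DepthGE R A n ↔ ∀ i < n, XV R (kk R) A i := by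
  rcases subsingleton_or_nontrivial A with hA | hA
  · constructor
    · intro _ i _
      rw [xv_iff]
      intro e
      have : e.comp (Ext.mk₀ (𝟙 (ModuleCat.of R A))) (add_zero i) = e := Ext.comp_mk₀_id _
      rw [← this]
      have h0 : 𝟙 (ModuleCat.of R A) = 0 := by
        ext x; exact Subsingleton.elim (α := A) _ _
      rw [h0, Ext.mk₀_zero, Ext.comp_zero]
    · intro _
      exact ⟨List.replicate n 0, by simp, by simp +contextual [List.mem_replicate], subsing_weak _⟩
  · have hlt : IsLocalRing.maximalIdeal R • (⊤ : Submodule R (ModuleCat.of R A)) < ⊤ := by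
      rw [lt_top_iff_ne_top]
      intro h
      have : (⊤ : Submodule R A) = ⊥ := by
        apply Submodule.eq_bot_of_le_smul_of_le_jacobson_bot (IsLocalRing.maximalIdeal R) _
          (Module.finite_def.1 inferInstance) h.ge
        rw [IsLocalRing.jacobson_eq_maximalIdeal]
        exact bot_ne_top
      exact top_ne_bot this
    have hsupp : Module.support R (kk R) =
        PrimeSpectrum.zeroLocus (IsLocalRing.maximalIdeal R) := by
      rw [Module.support_eq_zeroLocus, Ideal.annihilator_quotient]
    constructor
    · rintro ⟨rs, rfl, hmem, hreg⟩ i hi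
      refine ModuleCat.subsingleton_ext_of_exists_isRegular (IsLocalRing.maximalIdeal R)
        (ModuleCat.of R (kk R)) hsupp.subset (ModuleCat.of R A) hlt rs hmem ⟨hreg, ?_⟩ i hi
      intro h
      refine hlt.ne (top_le_iff.1 (h.le.trans (Submodule.smul_mono_left ?_)))
      rw [Ideal.ofList, Ideal.span_le]
      exact hmem
    · intro H
      obtain ⟨rs, h1, h2, h3⟩ := ModuleCat.exists_isRegular_of_exists_subsingleton_ext
        (IsLocalRing.maximalIdeal R) n (ModuleCat.of R A) hlt (ModuleCat.of R (kk R)) hsupp H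
      exact ⟨rs, h1, h2, h3.toIsWeaklyRegular⟩

lemma depth_mono [Module.Finite R A] {m n : ℕ} (hmn : m ≤ n) (h : DepthGE R A n) :
    DepthGE R A m := by
  rw [depth_iff] at *
  exact fun i hi => h i (by omega)

lemma depth_congr [Module.Finite R A] [Module.Finite R B] (e : A ≃ₗ[R] B) {n : ℕ} (h : DepthGE R A n) :
    DepthGE R B n := by
  rw [depth_iff] at *
  exact fun i hi => xv_congr_right e (h i hi)

lemma depth_ker [Module.Finite R A] [Module.Finite R B] [Module.Finite R C]
    {f : A →ₗ[R] B} {g : B →ₗ[R] C} (h : Function.Exact f g)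
    (hf : Function.Injective f) (hg : Function.Surjective g) {n : ℕ}
    (hB : DepthGE R B (n+1)) (hC : DepthGE R C n) : DepthGE R A (n+1) := by
  rw [depth_iff] at *
  intro i hi
  cases i with
  | zero => exact cov1_zero hf (hB 0 hi)
  | succ i => exact cov1 h hf hg (hC i (by omega)) (hB _ hi)

lemma depth_ker' [Module.Finite R A] [Module.Finite R B] [Module.Finite R C]
    {f : A →ₗ[R] B} {g : B →ₗ[R] C} (h : Function.Exact f g)
    (hf : Function.Injective f) (hg : Function.Surjective g) {n : ℕ}
    (hB : DepthGE R B n) (hC : DepthGE R C n) : DepthGE R A n := by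
  cases n with
  | zero => exact ⟨[], by simp⟩
  | succ n => exact depth_ker h hf hg hB (depth_mono (Nat.le_succ n) hC)

lemma depth_pi {n : ℕ} (hR : DepthGE R R n) (m : ℕ) : DepthGE R (Fin m → R) n := by
  induction m with
  | zero =>
    rw [depth_iff]
    rw [depth_iff] at hR
    intro i hi
    have := (depth_iff (R := R) (A := Fin 0 → R) n).1
      ⟨List.replicate n 0, by simp, by simp +contextual [List.mem_replicate], subsing_weak _⟩
    exact this i hi
  | succ m ih =>
    refine depth_congr (Fin.consLinearEquiv R (fun _ : Fin (m+1) => R)) ?_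
    rw [depth_iff] at *
    intro i hi
    exact cov2 (f := LinearMap.inl R R (Fin m → R)) (g := LinearMap.snd R R (Fin m → R))
      (by intro x; simp [Prod.ext_iff, eq_comm]) LinearMap.inl_injective LinearMap.snd_surjective
      (hR i hi) (ih i hi)

lemma depth_proj {n : ℕ} (hR : DepthGE R R n) [Module.Finite R A] [Module.Projective R A] :
    DepthGE R A n := by
  have : Module.Free R A := Module.free_of_flat_of_isLocalRing
  exact depth_congr (Module.finBasis R A).equivFun.symm (depth_pi hR _)

end
end Pf

namespace Pf

open CategoryTheory CategoryTheory.Abelian Limits Paper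

section
variable {R : Type} [CommRing R]
variable {A B C Y : Type} [AddCommGroup A] [Module R A] [AddCommGroup B] [Module R B]
  [AddCommGroup C] [Module R C] [AddCommGroup Y] [Module R Y]

lemma cov3 {f : A →ₗ[R] B} {g : B →ₗ[R] C} (h : Function.Exact f g)
    (hf : Function.Injective f) (hg : Function.Surjective g)
    {n : ℕ} (h1 : XV R Y B n) (h2 : XV R Y A (n+1)) : XV R Y C n := by
  rw [xv_iff] at *
  intro e
  obtain ⟨y, rfl⟩ := Ext.covariant_sequence_exact₃ (ModuleCat.of R Y) (sc_exact h hf hg) e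
    rfl (h2 _)
  obtain rfl := h1 y
  exact Ext.zero_comp ..

lemma xv_subsing [Subsingleton A] (n : ℕ) : XV R A Y n := by
  rw [xv_iff]
  intro e
  have : (Ext.mk₀ (𝟙 (ModuleCat.of R A))).comp e (zero_add n) = e := Ext.mk₀_id_comp _
  rw [← this]
  have h0 : 𝟙 (ModuleCat.of R A) = 0 := by
    ext x; exact Subsingleton.elim (α := A) _ _
  rw [h0, Ext.mk₀_zero, Ext.zero_comp]

lemma baer_global (n : ℕ) : ∀ (J : Type) [AddCommGroup J] [Module R J]
    (_ : ∀ I : Ideal R, XV R (R ⧸ I) J (n+1)) (M : Type) [AddCommGroup M] [Module R M],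
    XV R M J (n+1) := by
  induction n with
  | zero =>
    intro J _ _ H M _ _
    have hb : Module.Baer R J := by
      intro I g
      obtain ⟨ψ, hψ⟩ := xv_one_extend (f := I.subtype) (g := I.mkQ)
        (by rw [LinearMap.exact_iff]; simp) (Submodule.subtype_injective I)
        (Submodule.mkQ_surjective I) (H I) g
      exact ⟨ψ, fun x mem => LinearMap.congr_fun hψ ⟨x, mem⟩⟩
    have hi : Module.Injective R J := hb.injective
    have : Injective (ModuleCat.of R J) := (Module.injective_iff_injective_object R J).1 hi
    rw [xv_iff]
    exact fun e => Ext.eq_zero_of_injective _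
  | succ n ih =>
    intro J _ _ H M _ _
    let ⟨E, _, f, hf⟩ := EnoughInjectives.presentation (ModuleCat.of R J)
    have injf : Function.Injective f.hom := (ModuleCat.mono_iff_injective f).mp hf
    have hE : ∀ (M : Type) [AddCommGroup M] [Module R M] (m : ℕ), XV R M E (m+1) := by
      intro M _ _ m
      rw [xv_iff]
      intro e
      exact Ext.eq_zero_of_injective _
    have hex := f.hom.exact_map_mkQ_range
    have h1 := ih (E ⧸ LinearMap.range f.hom)
      (fun I => cov3 hex injf (Submodule.mkQ_surjective _) (hE _ _) (H I)) M
    exact cov1 hex injf (Submodule.mkQ_surjective _) h1 (hE _ _)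

end

section

variable {R : Type} [CommRing R] [IsLocalRing R] [IsNoetherianRing R]

lemma bass_prime (Y : Type) [AddCommGroup Y] [Module R Y] [Module.Finite R Y] (n : ℕ)
    (hk : ∀ i ≥ n, XV R (kk R) Y i) (p : Ideal R) :
    p.IsPrime → ∀ i ≥ n, XV R (R ⧸ p) Y i := by
  induction p using WellFoundedGT.induction with
  | ind p ih =>
  intro hp i hi
  by_cases hpm : p = IsLocalRing.maximalIdeal R
  · subst hpm; exact hk i hi
  have hlt : p < IsLocalRing.maximalIdeal R :=
    lt_of_le_of_ne (IsLocalRing.le_maximalIdeal hp.ne_top) hpm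
  obtain ⟨x, hxm, hxp⟩ := SetLike.exists_of_lt hlt
  apply nak hxm
  · intro a b hab
    obtain ⟨a, rfl⟩ := Ideal.Quotient.mk_surjective a
    obtain ⟨b, rfl⟩ := Ideal.Quotient.mk_surjective b
    have h1 : Ideal.Quotient.mk p (x * a) = Ideal.Quotient.mk p (x * b) := hab
    rw [Ideal.Quotient.eq, ← mul_sub] at h1
    exact Ideal.Quotient.eq.2 ((hp.mem_or_mem h1).resolve_left hxp)
  · have key := IsNoetherianRing.induction_on_isQuotientEquivQuotientPrime R
      (M := QuotSMulTop x (R ⧸ p)) inferInstance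
      (motive := fun N _ _ _ => (∀ r ∈ p ⊔ Ideal.span {x}, ∀ z : N, r • z = 0) →
        ∀ i ≥ n, XV R N Y i) ?_ ?_ ?_
    · refine key ?_ (i+1) (by omega)
      intro r hr z
      obtain ⟨a, ha, b, hb, rfl⟩ := Submodule.mem_sup.1 hr
      obtain ⟨c, rfl⟩ := Ideal.mem_span_singleton'.1 hb
      obtain ⟨z, rfl⟩ := Submodule.mkQ_surjective _ z
      have h1 : a • z = 0 := by
        obtain ⟨z, rfl⟩ := Ideal.Quotient.mk_surjective z
        exact Ideal.Quotient.eq_zero_iff_mem.2 (p.mul_mem_right z ha)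
      rw [← map_smul, Submodule.mkQ_apply, Submodule.Quotient.mk_eq_zero, add_smul, h1, zero_add,
        mul_comm, mul_smul]
      exact Submodule.smul_mem_pointwise_smul _ _ _ trivial
    · intro N _ _ _ _ _ i _
      exact xv_subsing i
    · intro N _ _ _ q e hN i hi
      refine xv_congr_left e.symm (ih q.1 ?_ q.2 i hi)
      have hle : p ⊔ Ideal.span {x} ≤ q.1 := by
        intro r hr
        have h1 := hN r hr (e.symm (Ideal.Quotient.mk _ 1))
        rw [← map_smul, LinearEquiv.map_eq_zero_iff] at h1
        have h2 : Ideal.Quotient.mk q.1 (r * 1) = 0 := h1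
        simpa [Ideal.Quotient.eq_zero_iff_mem] using h2
      refine lt_of_le_of_ne (le_sup_left.trans hle) ?_
      rintro h
      apply hxp
      rw [h]
      exact hle (Ideal.mem_sup_right (Ideal.mem_span_singleton_self x))
    · intro N₁ _ _ _ N₂ _ _ _ N₃ _ _ _ f g hf hg hfg h1 h3 hN i hi
      refine con2 hfg hf hg (h1 ?_ i hi) (h3 ?_ i hi)
      · intro r hr z
        apply hf
        rw [map_smul, hN r hr, map_zero]
      · intro r hr z
        obtain ⟨z, rfl⟩ := hg z
        rw [← map_smul, hN r hr, map_zero]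

lemma bass (Y : Type) [AddCommGroup Y] [Module R Y] [Module.Finite R Y] (n : ℕ)
    (hk : ∀ i ≥ n, XV R (kk R) Y i) (M : Type) [AddCommGroup M] [Module R M] [Module.Finite R M] :
    ∀ i ≥ n, XV R M Y i := by
  refine IsNoetherianRing.induction_on_isQuotientEquivQuotientPrime R
      (M := M) inferInstance
      (motive := fun N _ _ _ => ∀ i ≥ n, XV R N Y i) ?_ ?_ ?_
  · intro N _ _ _ _ i _
    exact xv_subsing i
  · intro N _ _ _ q e i hi
    exact xv_congr_left e.symm (bass_prime Y n hk q.1 q.2 i hi)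
  · intro N₁ _ _ _ N₂ _ _ _ N₃ _ _ _ f g hf hg hfg h1 h3 i hi
    exact con2 hfg hf hg (h1 i hi) (h3 i hi)

lemma gor_of_k (d : ℕ) (h : ∀ i > d, XV R (kk R) R i) : Gorenstein R := by
  refine ⟨d, fun i hi M => ?_⟩
  obtain ⟨j, rfl⟩ : ∃ j, i = j + 1 := ⟨i - 1, by omega⟩
  rw [extVanish_iff]
  exact baer_global j R (fun I => bass R (d+1) h (R ⧸ I) _ hi) M

/-- the residue field embeds into the quotient by a maximal regular sequence -/
lemma k_embeds (d : ℕ) (hdim : ringKrullDim R = (d : ℕ)) (rs : List R) (hlen : rs.length = d)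
    (reg : RingTheory.Sequence.IsRegular R rs) :
    ∃ f : kk R →ₗ[R] (R ⧸ Ideal.ofList rs), Function.Injective f := by
  have h0 := ringKrullDim_add_length_eq_ringKrullDim_of_isRegular rs reg
  have hne : Ideal.ofList rs ≠ ⊤ := by
    intro h
    apply reg.2
    rw [h]; simp
  have : Nontrivial (R ⧸ Ideal.ofList rs) := Ideal.Quotient.nontrivial_iff.2 hne
  obtain ⟨p, hp⟩ := associatedPrimes.nonempty R (R ⧸ Ideal.ofList rs)
  have hpr : p.IsPrime := hp.isPrime
  have hann : Ideal.ofList rs ≤ p := by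
    have := hp.annihilator_le
    rwa [Submodule.annihilator_top, Ideal.annihilator_quotient] at this
  have hQ : ringKrullDim (R ⧸ Ideal.ofList rs) ≤ 0 := by
    rw [hdim, hlen] at h0
    have h2 : ringKrullDim (R ⧸ Ideal.ofList rs) + (d : WithBot ℕ∞) ≤ 0 + (d : WithBot ℕ∞) := by
      rw [zero_add]; exact h0.le
    revert h2
    generalize ringKrullDim (R ⧸ Ideal.ofList rs) = t
    intro h2
    induction t using WithBot.recBotCoe with
    | bot => exact bot_le
    | coe t =>
      induction t using ENat.recTopCoe with
      | top =>
        exfalso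
        have h3 : ((⊤ + (d : ℕ∞) : ℕ∞) : WithBot ℕ∞) ≤ ((0 + d : ℕ∞) : WithBot ℕ∞) := h2
        rw [WithBot.coe_le_coe] at h3
        simp at h3
      | coe t =>
        have h3 : (((t : ℕ∞) + (d : ℕ∞) : ℕ∞) : WithBot ℕ∞) ≤ ((0 + d : ℕ∞) : WithBot ℕ∞) := h2
        rw [WithBot.coe_le_coe] at h3
        have h4 : t + d ≤ 0 + d := by exact_mod_cast h3
        have h5 : t = 0 := by omega
        subst h5
        exact le_rfl
  have hP : ringKrullDim (R ⧸ p) ≤ 0 :=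
    (ringKrullDim_le_of_surjective (Ideal.Quotient.factor hann)
      (Ideal.Quotient.factor_surjective hann)).trans hQ
  have hpm : p = IsLocalRing.maximalIdeal R := by
    have : Ring.KrullDimLE 0 (R ⧸ p) := (Order.krullDimLE_iff _ _).2 hP
    exact IsLocalRing.eq_maximalIdeal
      (Ideal.Quotient.maximal_of_isField _ Ring.KrullDimLE.isField_of_isDomain)
  subst hpm
  exact (isAssociatedPrime_iff_exists_injective_linearMap _ _).1 hp |>.2

lemma gor_bound (d : ℕ) (hdim : ringKrullDim R = (d : ℕ)) (hCM : DepthGE R R d)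
    (hG : Gorenstein R) (M : Type) [AddCommGroup M] [Module R M] [Module.Finite R M] :
    ∀ i > d, XV R M R i := by
  obtain ⟨rs, hlen, hmem, hw⟩ := hCM
  have reg : RingTheory.Sequence.IsRegular R rs := by
    refine ⟨hw, ?_⟩
    intro h
    have h1 : Ideal.ofList rs ≤ IsLocalRing.maximalIdeal R := by
      rw [Ideal.ofList, Ideal.span_le]; exact hmem
    have h2 : (⊤ : Ideal R) ≤ Ideal.ofList rs := by
      rw [h]; simp
    exact Ideal.IsPrime.ne_top' (top_le_iff.1 (h2.trans h1))
  obtain ⟨f, hf⟩ := k_embeds d hdim rs hlen reg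
  have hQ : ∀ i > d, XV R (R ⧸ Ideal.ofList rs) R i := by
    intro i hi
    have h1 := ModuleCat.projectiveDimension_quotient_eq_length.{0} rs reg
    have h2 : HasProjectiveDimensionLE (ModuleCat.of R (Shrink.{0} (R ⧸ Ideal.ofList rs))) d := by
      rw [← projectiveDimension_le_iff, h1, hlen]
    have h3 : XV R (Shrink.{0} (R ⧸ Ideal.ofList rs)) R i :=
      HasProjectiveDimensionLT.subsingleton _ (d+1) i hi _
    exact xv_congr_left (Shrink.linearEquiv R _) h3
  obtain ⟨n, hn⟩ := hG
  have key : ∀ k, ∀ (M : Type) [AddCommGroup M] [Module R M] [Module.Finite R M],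
      ∀ i, i > d → i + k > n → XV R M R i := by
    intro k
    induction k with
    | zero =>
      intro M _ _ _ i hi hk
      obtain ⟨j, rfl⟩ : ∃ j, i = j + 1 := ⟨i - 1, by omega⟩
      exact (extVanish_iff (ModuleCat.of R M) (ModuleCat.of R R) j).1 (hn (j+1) hk _)
    | succ k ih =>
      intro M _ _ _ i hi hk
      refine bass R i ?_ M i le_rfl
      intro j hj
      exact con1 f.exact_map_mkQ_range hf (Submodule.mkQ_surjective _) (hQ j (by omega))
        (ih _ (j+1) (by omega) (by omega))
  exact fun i hi => key (n+1) M i hi (by omega)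

lemma gor_mcm (d : ℕ) (hdim : ringKrullDim R = (d : ℕ)) (hCM : DepthGE R R d)
    (hG : Gorenstein R) (j : ℕ) : ∀ (M : Type) [AddCommGroup M] [Module R M] [Module.Finite R M],
    DepthGE R M j → ∀ i, i + j > d → XV R M R i := by
  induction j with
  | zero =>
    intro M _ _ _ _ i hi
    exact gor_bound d hdim hCM hG M i hi
  | succ j ih =>
    rintro M _ _ _ ⟨rs, hlen, hmem, hw⟩ i hi
    match rs with
    | [] => simp at hlen
    | x :: rs =>
      rw [RingTheory.Sequence.isWeaklyRegular_cons_iff] at hw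
      refine nak (hmem x (by simp)) hw.1 (ih _ ⟨rs, by simpa using hlen, ?_, hw.2⟩ _ (by omega))
      exact fun y hy => hmem y (by simp [hy])

end
end Pf

namespace Pf

open CategoryTheory CategoryTheory.Abelian Limits Paper

section
variable {R : Type} [CommRing R]
variable {A B C Y : Type} [AddCommGroup A] [Module R A] [AddCommGroup B] [Module R B]
  [AddCommGroup C] [Module R C] [AddCommGroup Y] [Module R Y]
variable {f : A →ₗ[R] B} {g : B →ₗ[R] C}

lemma desc_exists (h : Function.Exact f g) (hg : Function.Surjective g)
    (u : B →ₗ[R] Y) (hu : u ∘ₗ f = 0) : ∃ w : C →ₗ[R] Y, w ∘ₗ g = u := by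
  have hk : LinearMap.ker g ≤ LinearMap.ker u := by
    intro b hb
    obtain ⟨a, rfl⟩ := (h b).1 hb
    exact LinearMap.congr_fun hu a
  refine ⟨(LinearMap.ker g).liftQ u hk ∘ₗ (g.quotKerEquivOfSurjective hg).symm.toLinearMap, ?_⟩
  ext b
  have : (g.quotKerEquivOfSurjective hg).symm (g b) = (LinearMap.ker g).mkQ b := by
    rw [LinearEquiv.symm_apply_eq]; rfl
  simp [this]

lemma lift_exists (h : Function.Exact f g) (hf : Function.Injective f)
    (u : Y →ₗ[R] B) (hu : g ∘ₗ u = 0) : ∃ v : Y →ₗ[R] A, f ∘ₗ v = u := by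
  have hr : ∀ y, u y ∈ LinearMap.range f := by
    intro y
    exact (h _).1 (LinearMap.congr_fun hu y)
  refine ⟨(LinearEquiv.ofInjective f hf).symm.toLinearMap ∘ₗ u.codRestrict _ hr, ?_⟩
  ext y
  have := (LinearEquiv.ofInjective f hf).apply_symm_apply (u.codRestrict _ hr y)
  exact congrArg Subtype.val this

lemma dual_exact (h : Function.Exact f g) (hg : Function.Surjective g) :
    Function.Exact g.dualMap f.dualMap := by
  intro φ
  constructor
  · intro hφ
    obtain ⟨w, hw⟩ := desc_exists h hg φ hφ
    exact ⟨w, hw⟩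
  · rintro ⟨w, rfl⟩
    ext a
    simp [h.apply_apply_eq_zero]

lemma dual_inj (hg : Function.Surjective g) : Function.Injective g.dualMap :=
  LinearMap.dualMap_injective_of_surjective hg

lemma ev_nat (b : B) : g.dualMap.dualMap (Module.Dual.eval R B b) = Module.Dual.eval R C (g b) := by
  ext; rfl

lemma ev_bij [Module.Finite R B] [Module.Projective R B] :
    Function.Bijective (Module.Dual.eval R B) := Module.bijective_dual_eval R B

/-- surjectivity of evaluation on the kernel -/
lemma ev_ker_surj [Module.Finite R B] [Module.Projective R B] (h : Function.Exact f g)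
    (hs : Function.Surjective f.dualMap)
    (hC : Function.Injective (Module.Dual.eval R C)) :
    Function.Surjective (Module.Dual.eval R A) := by
  intro α
  obtain ⟨b, hb⟩ := (ev_bij (R := R) (B := B)).2 (f.dualMap.dualMap α)
  have h1 : g b = 0 := by
    apply hC
    rw [← ev_nat, hb, map_zero]
    ext φ
    change α (f.dualMap (g.dualMap φ)) = 0
    have : f.dualMap (g.dualMap φ) = 0 := by
      ext a; simp [h.apply_apply_eq_zero]
    rw [this, map_zero]
  obtain ⟨a, rfl⟩ := (h b).1 h1
  refine ⟨a, ?_⟩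
  apply dual_inj hs
  rw [ev_nat, hb]

lemma ev_coker_surj [Module.Finite R B] [Module.Projective R B] (h : Function.Exact f g)
    (hg : Function.Surjective g) (hs : Function.Surjective f.dualMap)
    (hx : XV R (Module.Dual R A) R 1) : Function.Surjective (Module.Dual.eval R C) := by
  intro γ
  obtain ⟨ψ, hψ⟩ := xv_one_extend (dual_exact h hg) (dual_inj hg) hs hx γ
  obtain ⟨b, rfl⟩ := (ev_bij (R := R) (B := B)).2 ψ
  exact ⟨g b, by rw [← ev_nat, ← hψ]; rfl⟩

lemma ev_coker_inj [Module.Finite R B] [Module.Projective R B] (h : Function.Exact f g)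
    (hg : Function.Surjective g) (hs : Function.Surjective f.dualMap)
    (hA : Function.Surjective (Module.Dual.eval R A)) :
    Function.Injective (Module.Dual.eval R C) := by
  rw [injective_iff_map_eq_zero]
  intro c hc
  obtain ⟨b, rfl⟩ := hg c
  rw [← ev_nat] at hc
  obtain ⟨α, hα⟩ := (dual_exact (dual_exact h hg) hs _).1 hc
  obtain ⟨a, rfl⟩ := hA α
  rw [ev_nat] at hα
  rw [← (ev_bij (R := R) (B := B)).1 hα, h.apply_apply_eq_zero]

lemma xv_dual [Module.Finite R B] [Module.Projective R B]
    [Module.Projective R (Module.Dual R B)] (h : Function.Exact f g)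
    (hg : Function.Surjective g) (hs : Function.Surjective f.dualMap)
    (hC : Function.Surjective (Module.Dual.eval R C)) : XV R (Module.Dual R A) R 1 := by
  refine xv_one_of_extend (dual_exact h hg) (dual_inj hg) hs ?_
  intro φ
  obtain ⟨c, rfl⟩ := hC φ
  obtain ⟨b, rfl⟩ := hg c
  exact ⟨Module.Dual.eval R B b, ev_nat b⟩

lemma dual_surj_of_xv (h : Function.Exact f g) (hf : Function.Injective f)
    (hg : Function.Surjective g) (hx : XV R C R 1) : Function.Surjective f.dualMap := by
  intro φ
  exact xv_one_extend h hf hg hx φ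

lemma fin_surj (R M : Type) [CommRing R] [AddCommGroup M] [Module R M] [Module.Finite R M] :
    ∃ (n : ℕ) (p : (Fin n → R) →ₗ[R] M), Function.Surjective p := Module.Finite.exists_fin' R M

/-- existence of left approximations -/
lemma approx_exists [Module.Finite R (Module.Dual R A)] :
    ∃ (n : ℕ) (f : A →ₗ[R] (Fin n → R)), Function.Surjective f.dualMap := by
  obtain ⟨n, p, hp⟩ := fin_surj R (Module.Dual R A)
  refine ⟨n, LinearMap.pi fun i => p (Pi.single i 1), ?_⟩
  intro φ
  obtain ⟨v, rfl⟩ := hp φ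
  refine ⟨Fintype.linearCombination R v, ?_⟩
  ext a
  have : v = ∑ i, v i • (Pi.single i (1:R) : Fin n → R) := by
    ext j; simp [Finset.sum_apply, Pi.single_apply]
  conv_rhs => rw [this]
  simp [Fintype.linearCombination_apply, LinearMap.sum_apply, mul_comm]

lemma ev_inj_of_emb {n : ℕ} (a : A →ₗ[R] (Fin n → R)) (ha : Function.Injective a) :
    Function.Injective (Module.Dual.eval R A) := by
  rw [injective_iff_map_eq_zero]
  intro x hx
  apply ha
  rw [map_zero]
  ext i
  exact LinearMap.congr_fun hx (LinearMap.proj i ∘ₗ a)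

lemma approx_inj (hs : Function.Surjective f.dualMap)
    (hA : Function.Injective (Module.Dual.eval R A)) : Function.Injective f := by
  rw [injective_iff_map_eq_zero]
  intro x hx
  apply hA
  rw [map_zero]
  ext φ
  obtain ⟨ψ, rfl⟩ := hs φ
  simp [hx]

variable [IsNoetherianRing R] [IsLocalRing R]

/-- duals of MCM modules over a Gorenstein ring -/
lemma gor_dual (d : ℕ) (hd : 0 < d) (hdim : ringKrullDim R = (d : ℕ)) (hCM : DepthGE R R d)
    (hG : Gorenstein R) (j : ℕ) : ∀ (M : Type) [AddCommGroup M] [Module R M] [Module.Finite R M],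
    j ≤ d → DepthGE R M d → DepthGE R (Module.Dual R M) j := by
  induction j with
  | zero => intro M _ _ _ _ _; exact ⟨[], by simp⟩
  | succ j ih =>
    intro M _ _ _ hj hM
    obtain ⟨n, p, hp⟩ := fin_surj R M
    have hK : DepthGE R (LinearMap.ker p) d :=
      depth_ker' p.exact_subtype_ker_map Subtype.val_injective hp (depth_proj hCM) hM
    have hs := dual_surj_of_xv p.exact_subtype_ker_map Subtype.val_injective hp
      (gor_mcm d hdim hCM hG d M hM 1 (by omega))
    exact depth_ker (dual_exact p.exact_subtype_ker_map hp) (dual_inj hp) hs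
      (depth_mono hj (depth_proj hCM)) (ih _ (by omega) hK)

lemma gor_ev (d : ℕ) (hd : 0 < d) (hdim : ringKrullDim R = (d : ℕ)) (hCM : DepthGE R R d)
    (hG : Gorenstein R) (M : Type) [AddCommGroup M] [Module R M] [Module.Finite R M]
    (hM : DepthGE R M d) : Function.Bijective (Module.Dual.eval R M) := by
  have surj : ∀ (M : Type) [AddCommGroup M] [Module R M] [Module.Finite R M]
      (hM : DepthGE R M d), Function.Surjective (Module.Dual.eval R M) := by
    intro M _ _ _ hM
    obtain ⟨n, p, hp⟩ := fin_surj R M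
    have hK : DepthGE R (LinearMap.ker p) d :=
      depth_ker' p.exact_subtype_ker_map Subtype.val_injective hp (depth_proj hCM) hM
    have hs := dual_surj_of_xv p.exact_subtype_ker_map Subtype.val_injective hp
      (gor_mcm d hdim hCM hG d M hM 1 (by omega))
    exact ev_coker_surj p.exact_subtype_ker_map hp hs
      (gor_mcm d hdim hCM hG d _ (gor_dual d hd hdim hCM hG d _ le_rfl hK) 1 (by omega))
  refine ⟨?_, surj M hM⟩
  obtain ⟨n, p, hp⟩ := fin_surj R M
  have hK : DepthGE R (LinearMap.ker p) d :=
    depth_ker' p.exact_subtype_ker_map Subtype.val_injective hp (depth_proj hCM) hM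
  have hs := dual_surj_of_xv p.exact_subtype_ker_map Subtype.val_injective hp
    (gor_mcm d hdim hCM hG d M hM 1 (by omega))
  exact ev_coker_inj p.exact_subtype_ker_map hp hs (surj _ hK)

lemma gor_closed (d : ℕ) (hd : 0 < d) (hdim : ringKrullDim R = (d : ℕ)) (hCM : DepthGE R R d)
    (hG : Gorenstein R) [Module.Finite R A] [Module.Finite R B] [Module.Projective R B]
    [Module.Finite R C] (h : Function.Exact f g)
    (hg : Function.Surjective g) (hs : Function.Surjective f.dualMap) (hA : DepthGE R A d) :
    DepthGE R C d := by
  have hAd := gor_dual d hd hdim hCM hG d _ le_rfl hA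
  have h1 := ev_coker_surj h hg hs (gor_mcm d hdim hCM hG d _ hAd 1 (by omega))
  have h2 := ev_coker_inj h hg hs (gor_ev d hd hdim hCM hG A hA).2
  have hCd : DepthGE R (Module.Dual R C) d :=
    depth_ker' (dual_exact h hg) (dual_inj hg) hs (depth_proj hCM) hAd
  exact depth_congr (LinearEquiv.ofBijective _ ⟨h2, h1⟩).symm
    (gor_dual d hd hdim hCM hG d _ le_rfl hCd)

end
end Pf

namespace Pf

open CategoryTheory CategoryTheory.Abelian Limits Paper

section
variable {R : Type} [CommRing R] [IsNoetherianRing R] [IsLocalRing R]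
variable {A B C Y : Type} [AddCommGroup A] [Module R A] [AddCommGroup B] [Module R B]
  [AddCommGroup C] [Module R C] [AddCommGroup Y] [Module R Y]
variable {f : A →ₗ[R] B} {g : B →ₗ[R] C}

/-- closure under cosyzygies, unbundled -/
def CC (R : Type) [CommRing R] [IsLocalRing R] (d : ℕ) : Prop :=
  ∀ (A B C : Type) [AddCommGroup A] [Module R A] [AddCommGroup B] [Module R B]
    [AddCommGroup C] [Module R C] [Module.Finite R A] [Module.Finite R B] [Module.Projective R B]
    [Module.Finite R C] (f : A →ₗ[R] B) (g : B →ₗ[R] C), Function.Exact f g →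
    Function.Surjective g → Function.Surjective f.dualMap → DepthGE R A d → DepthGE R C d

/-- powers of elements of the maximal ideal factor through free modules -/
def QQ (R : Type) [CommRing R] [IsLocalRing R] (X : Type) [AddCommGroup X] [Module R X] : Prop :=
  ∀ x ∈ IsLocalRing.maximalIdeal R, ∃ (n m : ℕ) (a : X →ₗ[R] (Fin m → R))
    (b : (Fin m → R) →ₗ[R] X), b ∘ₗ a = x ^ n • LinearMap.id

lemma qq_mk [Module.Finite R B] [Module.Projective R B] {x : R} {n : ℕ} (a : A →ₗ[R] B)
    (b : B →ₗ[R] A) (h : b ∘ₗ a = x ^ n • LinearMap.id) :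
    ∃ (n m : ℕ) (a : A →ₗ[R] (Fin m → R))
    (b : (Fin m → R) →ₗ[R] A), b ∘ₗ a = x ^ n • LinearMap.id := by
  have : Module.Free R B := Module.free_of_flat_of_isLocalRing
  let e := (Module.finBasis R B).equivFun
  refine ⟨n, _, e.toLinearMap ∘ₗ a, b ∘ₗ e.symm.toLinearMap, ?_⟩
  rw [← h]
  ext y
  simp

lemma qq_kk : QQ R (kk R) := by
  intro x hx
  refine ⟨1, 0, 0, 0, ?_⟩
  refine LinearMap.ext fun y => ?_
  obtain ⟨y, rfl⟩ := Ideal.Quotient.mk_surjective y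
  simp only [LinearMap.comp_zero, pow_one]
  symm
  change Ideal.Quotient.mk _ (x * _) = 0
  rw [Ideal.Quotient.eq_zero_iff_mem]
  exact Ideal.mul_mem_right _ _ hx

lemma qq_syz [Module.Finite R B] [Module.Projective R B] (h : Function.Exact f g)
    (hf : Function.Injective f) (hg : Function.Surjective g) (hC : QQ R C) : QQ R A := by
  intro x hx
  obtain ⟨n, m, a, b, hab⟩ := hC x hx
  obtain ⟨b', hb'⟩ := Module.projective_lifting_property g b hg
  obtain ⟨v, hv⟩ := lift_exists h hf (x ^ n • LinearMap.id - b' ∘ₗ a ∘ₗ g) (by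
    ext y
    have h1 := LinearMap.congr_fun hb' (a (g y))
    have h2 := LinearMap.congr_fun hab (g y)
    simp only [LinearMap.comp_apply, LinearMap.smul_apply, LinearMap.id_apply] at h1 h2
    simp [h1, h2])
  refine qq_mk (n := n) f v ?_
  ext y
  apply hf
  have h1 := LinearMap.congr_fun hv (f y)
  simp only [LinearMap.comp_apply, LinearMap.sub_apply, LinearMap.smul_apply, LinearMap.id_apply,
    h.apply_apply_eq_zero, map_zero, sub_zero] at h1
  simp [h1]

lemma ext_pi (hs : Function.Surjective f.dualMap) {m : ℕ} (a : A →ₗ[R] (Fin m → R)) :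
    ∃ a' : B →ₗ[R] (Fin m → R), a' ∘ₗ f = a := by
  choose ψ hψ using fun i => hs (LinearMap.proj i ∘ₗ a)
  refine ⟨LinearMap.pi ψ, ?_⟩
  ext y i
  exact LinearMap.congr_fun (hψ i) y

lemma qq_cosyz [Module.Finite R B] [Module.Projective R B] (h : Function.Exact f g)
    (hg : Function.Surjective g) (hs : Function.Surjective f.dualMap) (hA : QQ R A) :
    QQ R C := by
  intro x hx
  obtain ⟨n, m, a, b, hab⟩ := hA x hx
  obtain ⟨a', ha'⟩ := ext_pi hs a
  obtain ⟨w, hw⟩ := desc_exists h hg (x ^ n • LinearMap.id - f ∘ₗ b ∘ₗ a') (by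
    ext y
    have h1 := LinearMap.congr_fun ha' y
    have h2 := LinearMap.congr_fun hab y
    simp only [LinearMap.comp_apply, LinearMap.smul_apply, LinearMap.id_apply] at h1 h2
    simp [h1, h2])
  refine qq_mk (n := n) w g ?_
  ext y
  obtain ⟨y, rfl⟩ := hg y
  have h1 := LinearMap.congr_fun hw y
  simp only [LinearMap.comp_apply, LinearMap.sub_apply, LinearMap.smul_apply,
    LinearMap.id_apply] at h1
  simp [h1, h.apply_apply_eq_zero]

lemma qq_dual (hA : QQ R A) : QQ R (Module.Dual R A) := by
  intro x hx
  obtain ⟨n, m, a, b, hab⟩ := hA x hx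
  refine qq_mk (n := n) b.dualMap a.dualMap ?_
  ext φ y
  have h2 := LinearMap.congr_fun hab y
  simp only [LinearMap.comp_apply, LinearMap.smul_apply, LinearMap.id_apply] at h2
  simp [h2]

lemma qq_ev_inj {d : ℕ} (hd : 0 < d) (hA : QQ R A) (hD : DepthGE R A d) :
    Function.Injective (Module.Dual.eval R A) := by
  obtain ⟨rs, hlen, hmem, hw⟩ := hD
  match rs with
  | [] => simp at hlen; omega
  | x :: rs =>
    rw [RingTheory.Sequence.isWeaklyRegular_cons_iff] at hw
    obtain ⟨n, m, a, b, hab⟩ := hA x (hmem x (by simp))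
    refine ev_inj_of_emb a ?_
    have h1 : Function.Injective (b ∘ₗ a) := by
      rw [hab]
      exact hw.1.pow n
    rw [LinearMap.coe_comp] at h1
    exact h1.of_comp

lemma approx_cosyz {d : ℕ} (hd : 0 < d) (hCC : CC R d) [Module.Finite R A]
    (hD : DepthGE R A d) (hA : QQ R A) :
    ∃ (n : ℕ) (f : A →ₗ[R] (Fin n → R)), Function.Injective f ∧ Function.Surjective f.dualMap ∧
      DepthGE R ((Fin n → R) ⧸ LinearMap.range f) d ∧ QQ R ((Fin n → R) ⧸ LinearMap.range f) := by
  obtain ⟨n, f, hs⟩ := approx_exists (R := R) (A := A)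
  exact ⟨n, f, approx_inj hs (qq_ev_inj hd hA hD), hs,
    hCC _ _ _ f _ f.exact_map_mkQ_range (Submodule.mkQ_surjective _) hs hD,
    qq_cosyz f.exact_map_mkQ_range (Submodule.mkQ_surjective _) hs hA⟩

lemma xx_ev {d : ℕ} (hd : 0 < d) (hCC : CC R d) [Module.Finite R A]
    (hD : DepthGE R A d) (hA : QQ R A) : Function.Bijective (Module.Dual.eval R A) := by
  refine ⟨qq_ev_inj hd hA hD, ?_⟩
  obtain ⟨n, f, hf, hs, h1, h2⟩ := approx_cosyz hd hCC hD hA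
  exact ev_ker_surj f.exact_map_mkQ_range hs (qq_ev_inj hd h2 h1)

lemma xx_xv_dual {d : ℕ} (hd : 0 < d) (hCC : CC R d) [Module.Finite R A]
    (hD : DepthGE R A d) (hA : QQ R A) : XV R (Module.Dual R A) R 1 := by
  obtain ⟨n, f, hf, hs, h1, h2⟩ := approx_cosyz hd hCC hD hA
  exact xv_dual f.exact_map_mkQ_range (Submodule.mkQ_surjective _) hs (xx_ev hd hCC h1 h2).2

lemma yy_xv {d : ℕ} (hd : 0 < d) (hCC : CC R d) [Module.Finite R A]
    (hD : DepthGE R A d) (hA : QQ R A) (hDd : DepthGE R (Module.Dual R A) d) : XV R A R 1 :=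
  xv_congr_left (LinearEquiv.ofBijective _ (xx_ev hd hCC hD hA)).symm
    (xx_xv_dual hd hCC hDd (qq_dual hA))

lemma yy_syz {d : ℕ} (hd : 0 < d) (hCC : CC R d) [Module.Finite R A] [Module.Finite R B]
    [Module.Projective R B] [Module.Finite R C] (h : Function.Exact f g)
    (hf : Function.Injective f) (hg : Function.Surjective g)
    (hD : DepthGE R C d) (hC : QQ R C) (hDd : DepthGE R (Module.Dual R C) d) :
    DepthGE R (Module.Dual R A) d := by
  have hs := dual_surj_of_xv h hf hg (yy_xv hd hCC hD hC hDd)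
  refine hCC _ _ _ g.dualMap f.dualMap (dual_exact h hg) hs ?_ hDd
  intro γ
  obtain ⟨c, rfl⟩ := (xx_ev hd hCC hD hC).2 γ
  obtain ⟨b, rfl⟩ := hg c
  exact ⟨_, ev_nat b⟩

lemma xx_yy {d : ℕ} (hd : 0 < d) (hCM : DepthGE R R d) (hCC : CC R d) (j : ℕ) :
    ∀ (k : ℕ) (X : Type) [AddCommGroup X] [Module R X] [Module.Finite R X], j + k = d →
    DepthGE R X d → QQ R X → DepthGE R (Module.Dual R X) k → DepthGE R (Module.Dual R X) d := by
  induction j with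
  | zero =>
    intro k X _ _ _ hk _ _ h
    rwa [← hk, zero_add]
  | succ j ih =>
    intro k X _ _ _ hk hD hQ h
    obtain ⟨n, f, hf, hs, h1, h2⟩ := approx_cosyz hd hCC hD hQ
    have h3 := depth_ker (dual_exact f.exact_map_mkQ_range (Submodule.mkQ_surjective _))
      (dual_inj (Submodule.mkQ_surjective _)) hs
      (depth_mono (show k + 1 ≤ d by omega) (depth_proj hCM)) h
    have h4 := ih (k+1) _ (by omega) h1 h2 h3
    exact yy_syz hd hCC f.exact_map_mkQ_range hf (Submodule.mkQ_surjective _) h1 h2 h4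

lemma xx_xv {d : ℕ} (hd : 0 < d) (hCM : DepthGE R R d) (hCC : CC R d) (i : ℕ) :
    ∀ (X : Type) [AddCommGroup X] [Module R X] [Module.Finite R X],
    DepthGE R X d → QQ R X → XV R X R (i+1) := by
  induction i with
  | zero =>
    intro X _ _ _ hD hQ
    exact yy_xv hd hCC hD hQ (xx_yy hd hCM hCC d 0 X (by omega) hD hQ ⟨[], by simp⟩)
  | succ i ih =>
    intro X _ _ _ hD hQ
    obtain ⟨n, p, hp⟩ := fin_surj R X
    have hK : DepthGE R (LinearMap.ker p) d :=
      depth_ker' p.exact_subtype_ker_map Subtype.val_injective hp (depth_proj hCM) hD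
    exact con3 p.exact_subtype_ker_map Subtype.val_injective hp
      (ih _ hK (qq_syz p.exact_subtype_ker_map Subtype.val_injective hp hQ)) (xv_proj _)

lemma qq_xv {d : ℕ} (hd : 0 < d) (hCM : DepthGE R R d) (hCC : CC R d) (j : ℕ) :
    ∀ (k : ℕ) (X : Type) [AddCommGroup X] [Module R X] [Module.Finite R X], j + k = d →
    DepthGE R X k → QQ R X → ∀ i > j, XV R X R i := by
  induction j with
  | zero =>
    intro k X _ _ _ hk hD hQ i hi
    obtain ⟨i, rfl⟩ : ∃ l, i = l + 1 := ⟨i - 1, by omega⟩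
    rw [zero_add] at hk
    subst hk
    exact xx_xv hd hCM hCC i X hD hQ
  | succ j ih =>
    intro k X _ _ _ hk hD hQ i hi
    obtain ⟨i, rfl⟩ : ∃ l, i = l + 1 := ⟨i - 1, by omega⟩
    obtain ⟨n, p, hp⟩ := fin_surj R X
    have hK : DepthGE R (LinearMap.ker p) (k+1) :=
      depth_ker p.exact_subtype_ker_map Subtype.val_injective hp
        (depth_mono (by omega) (depth_proj hCM)) hD
    exact con3 p.exact_subtype_ker_map Subtype.val_injective hp
      (ih (k+1) _ (by omega) hK (qq_syz p.exact_subtype_ker_map Subtype.val_injective hp hQ)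
        i (by omega)) (xv_proj _)

lemma gor_of_CC {d : ℕ} (hd : 0 < d) (hCM : DepthGE R R d) (hCC : CC R d) : Gorenstein R :=
  gor_of_k d (qq_xv hd hCM hCC d 0 (kk R) (by omega) ⟨[], by simp⟩ qq_kk)

end
end Pf

/-- a CM local ring of positive dimension is Gorenstein iff `CM(R)` is
closed under cosyzygies. -/
theorem stmt17 (R : Type) [CommRing R] [IsNoetherianRing R] [IsLocalRing R] (d : ℕ)
    (hd : 0 < d) (hdim : ringKrullDim R = (d : ℕ)) (hCM : DepthGE R R d) :
    Gorenstein R ↔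
      (∀ M : ModuleCat.{0} R, Module.Finite R M → DepthGE R M d →
        ∀ N, IsCosyzygy R N M → (Module.Finite R N ∧ DepthGE R N d)) := by
  constructor
  · rintro hG M hMf hM N ⟨P, f, ⟨⟨hPf, hPp⟩, hf⟩, ⟨e⟩⟩
    have hNf : Module.Finite R N := Module.Finite.equiv e.symm
    refine ⟨hNf, ?_⟩
    have hs : Function.Surjective f.dualMap := by
      intro φ
      exact hf (ModuleCat.of R R) ⟨inferInstanceAs (Module.Finite R R),
        inferInstanceAs (Module.Projective R R)⟩ φ
    have := Pf.gor_closed (A := M) (B := P) (C := P ⧸ LinearMap.range f) (f := f) d hd hdim hCM hG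
      f.exact_map_mkQ_range (Submodule.mkQ_surjective _) hs hM
    exact Pf.depth_congr e.symm this
  · intro H
    refine Pf.gor_of_CC hd hCM ?_
    intro A B C _ _ _ _ _ _ hA hB hBp hC f g h hg hs hD
    refine (H (ModuleCat.of R A) hA hD (ModuleCat.of R C) ⟨ModuleCat.of R B, f,
      ⟨⟨hB, hBp⟩, ?_⟩, ⟨?_⟩⟩).2
    · rintro Q ⟨hQf, hQp⟩ q
      have : Module.Free R Q := Module.free_of_flat_of_isLocalRing
      let e := (Module.finBasis R Q).equivFun
      obtain ⟨a', ha'⟩ := Pf.ext_pi (f := f) hs (e.toLinearMap ∘ₗ q)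
      refine ⟨e.symm.toLinearMap ∘ₗ a', ?_⟩
      ext y
      have := LinearMap.congr_fun ha' y
      simp only [LinearMap.comp_apply] at this
      change e.symm (a' (f y)) = q y
      rw [this]
      exact e.symm_apply_apply _
    · exact (g.quotKerEquivOfSurjective hg).symm.trans
        (Submodule.quotEquivOfEq _ _ h.linearMap_ker_eq)
end
end
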